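/- arXiv:2401.07987 — 2 statements merged into one kernel-verified Lean document; each statement's English description precedes it below -/
import Mathlib

section
/- Let R be a commutative noetherian ring with a dualizing module D, let G be a Gorenstein injective R-module, and let E be an injective R-module. Then for all k ≥ 0 there is an isomorphism Tor_k^R(E, Hom_R(D,G)) ≅ Tor_k^R(G, Hom_R(D,E)). -/
open CategoryTheory

universe u

/-- The `a`-torsion submodule `Γ_a(M) = {x ∈ M | a^n x = 0 for some n}`. -/
def torsionGamma {R : Type u} [CommRing R] (a : Ideal R) (M : Type u)
    [AddCommGroup M] [Module R M] : Submodule R M :=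
  ⨆ n : ℕ, Submodule.torsionBySet R M ((a ^ n : Ideal R) : Set R)

/-- Data witnessing that `G` is Gorenstein injective: a ℤ-indexed exact complex of
injective modules, remaining exact after `Hom_R(E', -)` for every injective `E'`,
with `G ≅ ker(E_0 → E_{-1})`. -/
structure GorensteinInjData (R : Type u) [CommRing R] (G : Type u)
    [AddCommGroup G] [Module R G] where
  E : ℤ → Type u
  [acg : ∀ i, AddCommGroup (E i)]
  [mod : ∀ i, Module R (E i)]
  d : ∀ i : ℤ, E (i + 1) →ₗ[R] E i
  inj : ∀ i, Module.Injective R (E i)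
  exact : ∀ i : ℤ, LinearMap.range (d (i + 1)) = LinearMap.ker (d i)
  homExact : ∀ (E' : Type u) [AddCommGroup E'] [Module R E'], Module.Injective R E' →
      ∀ (i : ℤ) (g : E' →ₗ[R] E (i + 1)),
        (d i).comp g = 0 ↔ ∃ f : E' →ₗ[R] E (i + 1 + 1), (d (i + 1)).comp f = g
  equiv : G ≃ₗ[R] LinearMap.ker (d (-1))

/-- An `R`-module `G` is Gorenstein injective. -/
def IsGorensteinInjective (R : Type u) [CommRing R] (G : Type u)
    [AddCommGroup G] [Module R G] : Prop :=
  Nonempty (GorensteinInjData R G)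

/-- Data witnessing that `M` is Gorenstein flat. -/
structure GorensteinFlatData (R : Type u) [CommRing R] (M : Type u)
    [AddCommGroup M] [Module R M] where
  F : ℤ → Type u
  [acg : ∀ i, AddCommGroup (F i)]
  [mod : ∀ i, Module R (F i)]
  d : ∀ i : ℤ, F (i + 1) →ₗ[R] F i
  flat : ∀ i, Module.Flat R (F i)
  exact : ∀ i : ℤ, LinearMap.range (d (i + 1)) = LinearMap.ker (d i)
  tensorExact : ∀ (E' : Type u) [AddCommGroup E'] [Module R E'], Module.Injective R E' →
      ∀ i : ℤ, LinearMap.range (LinearMap.lTensor E' (d (i + 1)))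
        = LinearMap.ker (LinearMap.lTensor E' (d i))
  equiv : M ≃ₗ[R] LinearMap.ker (d (-1))

/-- An `R`-module `M` is Gorenstein flat. -/
def IsGorensteinFlat (R : Type u) [CommRing R] (M : Type u)
    [AddCommGroup M] [Module R M] : Prop :=
  Nonempty (GorensteinFlatData R M)

/-- `E` is an injective hull of `M`: `E` is injective and admits an injective
linear map from `M` with essential image. -/
def IsInjectiveHull (R : Type u) [CommRing R] (M : Type u) [AddCommGroup M] [Module R M]
    (E : Type u) [AddCommGroup E] [Module R E] : Prop :=
  Module.Injective R E ∧ ∃ f : M →ₗ[R] E, Function.Injective f ∧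
    ∀ N : Submodule R E, N ≠ ⊥ → N ⊓ LinearMap.range f ≠ ⊥

/-- `D` is a dualizing module for `R`: finitely generated, of finite injective dimension,
the homothety map `R → Hom_R(D,D)` is bijective, and `Ext^i_R(D,D) = 0` for `i ≥ 1`. -/
def IsDualizingModule (R : Type u) [CommRing R] (D : Type u)
    [AddCommGroup D] [Module R D] : Prop :=
  Module.Finite R D ∧
  (∃ n : ℕ, ∀ (M : Type u) (_ : AddCommGroup M) (_ : Module R M), ∀ i : ℕ, n < i →
      Limits.IsZero (((Ext R (ModuleCat.{u} R) i).obj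
        (Opposite.op (ModuleCat.of R M))).obj (ModuleCat.of R D))) ∧
  Function.Bijective (fun r : R => (r • (LinearMap.id : D →ₗ[R] D))) ∧
  (∀ i : ℕ, 0 < i →
    Limits.IsZero (((Ext R (ModuleCat.{u} R) i).obj
      (Opposite.op (ModuleCat.of R D))).obj (ModuleCat.of R D)))

/-- The height of a prime ideal, as the `Order.height` of the corresponding
point of the prime spectrum. -/
noncomputable def idealHeight {R : Type u} [CommRing R] (p : Ideal R) (hp : p.IsPrime) : ℕ∞ :=
  Order.height (⟨p, hp⟩ : PrimeSpectrum R)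

section Towers
open TensorProduct

structure FTower (R : Type u) [CommRing R] where
  B : ℕ → ModuleCat.{u} R
  P : ℕ → ModuleCat.{u} R
  i : ∀ k, B (k + 1) →ₗ[R] P k
  p : ∀ k, P k →ₗ[R] B k
  flat : ∀ k, Module.Flat R (P k)
  inj : ∀ k, Function.Injective (i k)
  surj : ∀ k, Function.Surjective (p k)
  ex : ∀ k, Function.Exact (i k) (p k)

def FTower.tail {R : Type u} [CommRing R] (T : FTower R) : FTower R where
  B k := T.B (k + 1)
  P k := T.P (k + 1)
  i k := T.i (k + 1)
  p k := T.p (k + 1)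
  flat k := T.flat (k + 1)
  inj k := T.inj (k + 1)
  surj k := T.surj (k + 1)
  ex k := T.ex (k + 1)

variable {R : Type u} [CommRing R]

/-- kernels correspond under a commuting square of equivalences -/
theorem ker_equiv_of_square {A B A' B' : Type*} [AddCommGroup A] [AddCommGroup B]
    [AddCommGroup A'] [AddCommGroup B'] [Module R A] [Module R B] [Module R A'] [Module R B']
    (f : A →ₗ[R] B) (g : A' →ₗ[R] B') (e : A ≃ₗ[R] A') (e' : B ≃ₗ[R] B')
    (h : e'.toLinearMap ∘ₗ f = g ∘ₗ e.toLinearMap) :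
    Nonempty (LinearMap.ker f ≃ₗ[R] LinearMap.ker g) := by
  refine ⟨e.submoduleMap _ |>.trans (LinearEquiv.ofEq _ _ ?_)⟩
  ext x
  have h' : ∀ a, e' (f a) = g (e a) := fun a => LinearMap.congr_fun h a
  constructor
  · rintro ⟨a, ha, rfl⟩
    have ha' : f a = 0 := ha
    show g (e a) = 0
    rw [← h', ha', map_zero]
  · intro hx
    have hx' : g x = 0 := hx
    refine ⟨e.symm x, ?_, by simp⟩
    show f (e.symm x) = 0
    apply e'.injective
    rw [h', map_zero]; simpa using hx'

theorem ker_snake (T : FTower R) (k : ℕ) {A A' A'' : Type u} [AddCommGroup A] [AddCommGroup A']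
    [AddCommGroup A''] [Module R A] [Module R A'] [Module R A'']
    (f : A' →ₗ[R] A) (g : A →ₗ[R] A'') (hf : Function.Injective f) (hg : Function.Surjective g)
    (hfg : Function.Exact f g)
    (h1 : Function.Injective (LinearMap.lTensor A (T.i k))) :
    Nonempty (LinearMap.ker (LinearMap.lTensor A'' (T.i k)) ≃ₗ[R]
      LinearMap.ker (LinearMap.rTensor (T.B k) f)) := by
  have := T.flat k
  -- common cover: pairs
  have hfP : Function.Injective (LinearMap.rTensor (T.P k) f) :=
    Module.Flat.rTensor_preserves_injective_linearMap f hf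
  have exB : Function.Exact (LinearMap.rTensor (T.B (k+1)) f) (LinearMap.rTensor (T.B (k+1)) g) :=
    rTensor_exact _ hfg hg
  have exP : Function.Exact (LinearMap.rTensor (T.P k) f) (LinearMap.rTensor (T.P k) g) :=
    rTensor_exact _ hfg hg
  have exA : Function.Exact (LinearMap.lTensor A (T.i k)) (LinearMap.lTensor A (T.p k)) :=
    lTensor_exact _ (T.ex k) (T.surj k)
  have exA' : Function.Exact (LinearMap.lTensor A' (T.i k)) (LinearMap.lTensor A' (T.p k)) :=
    lTensor_exact _ (T.ex k) (T.surj k)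
  have sB := LinearMap.rTensor_surjective (T.B (k+1)) hg
  have sA' := LinearMap.lTensor_surjective A' (T.surj k)
  -- the submodule W of A ⊗ B (k+1) × A' ⊗ P k of compatible pairs
  let φ : (A ⊗[R] T.B (k+1)) × (A' ⊗[R] T.P k) →ₗ[R] A ⊗[R] T.P k :=
    (LinearMap.lTensor A (T.i k)).coprod (-(LinearMap.rTensor (T.P k) f))
  let W := LinearMap.ker φ
  have hW : ∀ w, w ∈ W ↔ LinearMap.lTensor A (T.i k) w.1 = LinearMap.rTensor (T.P k) f w.2 := by
    intro w
    show φ w = 0 ↔ _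
    simp only [φ, LinearMap.coprod_apply, LinearMap.neg_apply, ← sub_eq_add_neg, sub_eq_zero]
  have c1 : ∀ x : A ⊗[R] T.B (k+1), LinearMap.lTensor A'' (T.i k) (LinearMap.rTensor _ g x) =
      LinearMap.rTensor _ g (LinearMap.lTensor A (T.i k) x) := fun x => by
    rw [← LinearMap.comp_apply, ← LinearMap.comp_apply, LinearMap.lTensor_comp_rTensor,
      LinearMap.rTensor_comp_lTensor]
  have c2 : ∀ x : A' ⊗[R] T.P k, LinearMap.lTensor A (T.p k) (LinearMap.rTensor _ f x) =
      LinearMap.rTensor _ f (LinearMap.lTensor A' (T.p k) x) := fun x => by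
    rw [← LinearMap.comp_apply, ← LinearMap.comp_apply, LinearMap.lTensor_comp_rTensor,
      LinearMap.rTensor_comp_lTensor]
  have c3 : ∀ x : A' ⊗[R] T.B (k+1), LinearMap.lTensor A (T.i k) (LinearMap.rTensor _ f x) =
      LinearMap.rTensor _ f (LinearMap.lTensor A' (T.i k) x) := fun x => by
    rw [← LinearMap.comp_apply, ← LinearMap.comp_apply, LinearMap.lTensor_comp_rTensor,
      LinearMap.rTensor_comp_lTensor]
  let α : W →ₗ[R] LinearMap.ker (LinearMap.lTensor A'' (T.i k)) :=
    LinearMap.codRestrict _ (LinearMap.rTensor (T.B (k+1)) g ∘ₗ LinearMap.fst R _ _ ∘ₗ W.subtype) (by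
      rintro ⟨w, hw⟩
      show LinearMap.lTensor A'' (T.i k) (LinearMap.rTensor _ g w.1) = 0
      rw [c1, (hW w).1 hw]
      exact exP.apply_apply_eq_zero _)
  let β : W →ₗ[R] LinearMap.ker (LinearMap.rTensor (T.B k) f) :=
    LinearMap.codRestrict _ (LinearMap.lTensor A' (T.p k) ∘ₗ LinearMap.snd R _ _ ∘ₗ W.subtype) (by
      rintro ⟨w, hw⟩
      show LinearMap.rTensor (T.B k) f (LinearMap.lTensor A' (T.p k) w.2) = 0
      rw [← c2, ← (hW w).1 hw]
      exact exA.apply_apply_eq_zero _)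
  have hα : Function.Surjective α := by
    rintro ⟨t, ht⟩
    obtain ⟨s, rfl⟩ := sB t
    have : LinearMap.rTensor _ g (LinearMap.lTensor A (T.i k) s) = 0 := by rw [← c1]; exact ht
    obtain ⟨r, hr⟩ := (exP _).1 this
    exact ⟨⟨(s, r), (hW _).2 hr.symm⟩, rfl⟩
  have hβ : Function.Surjective β := by
    rintro ⟨t, ht⟩
    obtain ⟨s, rfl⟩ := sA' t
    have : LinearMap.lTensor _ (T.p k) (LinearMap.rTensor _ f s) = 0 := by rw [c2]; exact ht
    obtain ⟨r, hr⟩ := (exA _).1 this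
    exact ⟨⟨(r, s), (hW _).2 hr⟩, rfl⟩
  have hk : LinearMap.ker α = LinearMap.ker β := by
    ext ⟨w, hw⟩
    have e1 : (⟨w, hw⟩ : W) ∈ LinearMap.ker α ↔ LinearMap.rTensor (T.B (k+1)) g w.1 = 0 := by
      rw [LinearMap.mem_ker, Subtype.ext_iff]; rfl
    have e2 : (⟨w, hw⟩ : W) ∈ LinearMap.ker β ↔ LinearMap.lTensor A' (T.p k) w.2 = 0 := by
      rw [LinearMap.mem_ker, Subtype.ext_iff]; rfl
    rw [e1, e2]
    have hw' := (hW w).1 hw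
    constructor
    · intro h
      obtain ⟨r, hr⟩ := (exB _).1 h
      rw [← hr, c3] at hw'
      rw [← hfP hw']
      exact exA'.apply_apply_eq_zero _
    · intro h
      obtain ⟨r, hr⟩ := (exA' _).1 h
      rw [← hr, ← c3] at hw'
      rw [h1 hw']
      exact exB.apply_apply_eq_zero _
  exact ⟨(α.quotKerEquivOfSurjective hα).symm ≪≫ₗ Submodule.quotEquivOfEq _ _ hk ≪≫ₗ
    (β.quotKerEquivOfSurjective hβ)⟩

theorem ker_shift (T : FTower R) (k : ℕ) {A A' A'' : Type u} [AddCommGroup A] [AddCommGroup A']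
    [AddCommGroup A''] [Module R A] [Module R A'] [Module R A'']
    (f : A' →ₗ[R] A) (g : A →ₗ[R] A'') (hf : Function.Injective f) (hg : Function.Surjective g)
    (hfg : Function.Exact f g)
    (h1 : Function.Injective (LinearMap.lTensor A (T.i k)))
    (h2 : Function.Injective (LinearMap.lTensor A (T.i (k+1)))) :
    Nonempty (LinearMap.ker (LinearMap.lTensor A'' (T.i (k+1))) ≃ₗ[R]
      LinearMap.ker (LinearMap.lTensor A' (T.i k))) := by
  obtain ⟨e⟩ := ker_snake T (k+1) f g hf hg hfg h2
  have := T.flat k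
  have hfP : Function.Injective (LinearMap.rTensor (T.P k) f) :=
    Module.Flat.rTensor_preserves_injective_linearMap f hf
  refine ⟨e ≪≫ₗ LinearEquiv.ofEq _ _ ?_⟩
  have c3 : ∀ x : A' ⊗[R] T.B (k+1), LinearMap.lTensor A (T.i k) (LinearMap.rTensor _ f x) =
      LinearMap.rTensor _ f (LinearMap.lTensor A' (T.i k) x) := fun x => by
    rw [← LinearMap.comp_apply, ← LinearMap.comp_apply, LinearMap.lTensor_comp_rTensor,
      LinearMap.rTensor_comp_lTensor]
  ext x
  rw [LinearMap.mem_ker, LinearMap.mem_ker]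
  constructor
  · intro h
    apply hfP
    rw [← c3, h, map_zero, map_zero]
  · intro h
    apply h1
    rw [c3, h, map_zero, map_zero]

theorem tower_symm (D : Type u) [AddCommGroup D] [Module R D] (k : ℕ) : ∀ (X Y : FTower R)
    (_ : ∀ n, Function.Injective (LinearMap.lTensor D (X.i n)))
    (_ : ∀ n, Function.Injective (LinearMap.lTensor D (Y.i n))),
    Nonempty (LinearMap.ker (LinearMap.lTensor (D ⊗[R] Y.B 0) (X.i k)) ≃ₗ[R]
      LinearMap.ker (LinearMap.lTensor (D ⊗[R] X.B 0) (Y.i k))) := by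
  have hfl : ∀ (X Y : FTower R) (_ : ∀ n, Function.Injective (LinearMap.lTensor D (Y.i n))) (n : ℕ),
      Function.Injective (LinearMap.lTensor (D ⊗[R] X.P 0) (Y.i n)) := by
    intro X Y hY n
    have := X.flat 0
    have h := Module.Flat.lTensor_preserves_injective_linearMap (M := X.P 0) _ (hY n)
    have h2 : LinearMap.lTensor (D ⊗[R] X.P 0) (Y.i n) =
        ((TensorProduct.comm R D (X.P 0)).rTensor _ ≪≫ₗ
          TensorProduct.assoc R (X.P 0) D (Y.P n)).symm.toLinearMap ∘ₗ
        LinearMap.lTensor (X.P 0) (LinearMap.lTensor D (Y.i n)) ∘ₗ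
        ((TensorProduct.comm R D (X.P 0)).rTensor _ ≪≫ₗ
          TensorProduct.assoc R (X.P 0) D (Y.B (n+1))).toLinearMap := by
      apply TensorProduct.ext_threefold
      intro a b c
      simp
    rw [h2]
    simp only [LinearMap.coe_comp, LinearEquiv.coe_coe]
    exact (LinearEquiv.injective _).comp (h.comp (LinearEquiv.injective _))
  induction k with
  | zero =>
    intro X Y hX hY
    obtain ⟨e⟩ := ker_snake Y 0 (LinearMap.lTensor D (X.i 0)) (LinearMap.lTensor D (X.p 0))
      (hX 0) (LinearMap.lTensor_surjective _ (X.surj 0)) (lTensor_exact _ (X.ex 0) (X.surj 0))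
      (hfl X Y hY 0)
    obtain ⟨e'⟩ := ker_equiv_of_square (LinearMap.lTensor (D ⊗[R] Y.B 0) (X.i 0))
      (LinearMap.rTensor (Y.B 0) (LinearMap.lTensor D (X.i 0)))
      (TensorProduct.rightComm R D (Y.B 0) (X.B 1)) (TensorProduct.rightComm R D (Y.B 0) (X.P 0))
      (by
        apply TensorProduct.ext_threefold
        intro a b c
        simp)
    exact ⟨e' ≪≫ₗ e.symm⟩
  | succ k ih =>
    intro X Y hX hY
    obtain ⟨e⟩ := ker_shift Y k (LinearMap.lTensor D (X.i 0)) (LinearMap.lTensor D (X.p 0))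
      (hX 0) (LinearMap.lTensor_surjective _ (X.surj 0)) (lTensor_exact _ (X.ex 0) (X.surj 0))
      (hfl X Y hY k) (hfl X Y hY (k+1))
    obtain ⟨e'⟩ := ih X.tail Y (fun n => hX (n+1)) hY
    exact ⟨e' ≪≫ₗ e.symm⟩

theorem lTensor_inj_congr {A A' B C : Type*} [AddCommGroup A] [AddCommGroup A'] [AddCommGroup B]
    [AddCommGroup C] [Module R A] [Module R A'] [Module R B] [Module R C] (e : A ≃ₗ[R] A')
    (f : B →ₗ[R] C) :
    Nonempty (LinearMap.ker (LinearMap.lTensor A f) ≃ₗ[R] LinearMap.ker (LinearMap.lTensor A' f)) := by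
  refine ker_equiv_of_square _ _ (e.rTensor B) (e.rTensor C) ?_
  apply TensorProduct.ext'
  intro a b
  simp

theorem inj_of_ker_equiv {A B A' B' : Type*} [AddCommGroup A] [AddCommGroup B]
    [AddCommGroup A'] [AddCommGroup B'] [Module R A] [Module R B] [Module R A'] [Module R B']
    {f : A →ₗ[R] B} {g : A' →ₗ[R] B'} (e : LinearMap.ker f ≃ₗ[R] LinearMap.ker g)
    (h : Function.Injective g) : Function.Injective f := by
  rw [← LinearMap.ker_eq_bot] at h ⊢
  rw [h] at e
  exact (Submodule.subsingleton_iff_eq_bot).1 e.toEquiv.subsingleton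

/-- vanishing symmetry -/
theorem tower_vanish_symm (X Y : FTower R) (k : ℕ)
    (h : Function.Injective (LinearMap.lTensor (X.B 0) (Y.i k))) :
    Function.Injective (LinearMap.lTensor (Y.B 0) (X.i k)) := by
  have hR : ∀ (X : FTower R) n, Function.Injective (LinearMap.lTensor R (X.i n)) := fun X n =>
    Module.Flat.lTensor_preserves_injective_linearMap _ (X.inj n)
  obtain ⟨e⟩ := tower_symm R k X Y (hR X) (hR Y)
  obtain ⟨e1⟩ := lTensor_inj_congr (TensorProduct.lid R (Y.B 0)) (X.i k)
  obtain ⟨e2⟩ := lTensor_inj_congr (TensorProduct.lid R (X.B 0)) (Y.i k)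
  exact inj_of_ker_equiv (e1.symm ≪≫ₗ e ≪≫ₗ e2) h

end Towers

section TorContact
open TensorProduct MonoidalCategory

variable {R : Type u} [CommRing R]

theorem res_exact {B : ModuleCat.{u} R} (P : ProjectiveResolution B) (n : ℕ) :
    Function.Exact (P.complex.d (n+2) (n+1)).hom (P.complex.d (n+1) n).hom := by
  have := P.exact_succ n
  rw [ShortComplex.ShortExact.moduleCat_exact_iff_function_exact] at this
  exact this

theorem res_dd {B : ModuleCat.{u} R} (P : ProjectiveResolution B) (n : ℕ) :
    (P.complex.d (n+1) n).hom ∘ₗ (P.complex.d (n+2) (n+1)).hom = 0 := by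
  rw [← ModuleCat.hom_comp, P.complex.d_comp_d]; rfl

noncomputable def resTower {B : ModuleCat.{u} R} (P : ProjectiveResolution B) : FTower R where
  B k := ModuleCat.of R (P.complex.X k ⧸ LinearMap.range (P.complex.d (k+1) k).hom)
  P k := P.complex.X k
  i k := Submodule.liftQ _ (P.complex.d (k+1) k).hom (by
    rw [LinearMap.range_le_ker_iff]; exact res_dd P k)
  p k := Submodule.mkQ _
  flat k := by
    have : Projective (P.complex.X k) := inferInstance
    have : Module.Projective R (P.complex.X k) := (IsProjective.iff_projective _).2 this
    infer_instance
  inj k := by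
    rw [← LinearMap.ker_eq_bot, Submodule.ker_liftQ_eq_bot']
    exact (LinearMap.exact_iff.1 (res_exact P k)).symm
  surj k := Submodule.mkQ_surjective _
  ex k := by
    rw [LinearMap.exact_iff, Submodule.ker_mkQ, Submodule.range_liftQ]

theorem resTower_zero {B : ModuleCat.{u} R} (P : ProjectiveResolution B) :
    Nonempty ((resTower P).B 0 ≃ₗ[R] B) := by
  have h := P.exact₀
  rw [ShortComplex.ShortExact.moduleCat_exact_iff_function_exact] at h
  have hs : Function.Surjective (P.π.f 0).hom := (ModuleCat.epi_iff_surjective _).1 inferInstance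
  exact ⟨Submodule.quotEquivOfEq _ _ (LinearMap.exact_iff.1 h).symm ≪≫ₗ
    LinearMap.quotKerEquivOfSurjective (P.π.f 0).hom hs⟩

theorem sc_homology (S : ShortComplex (ModuleCat.{u} R)) {C : Type u} [AddCommGroup C] [Module R C]
    (p : S.X₂ →ₗ[R] C) (i : C →ₗ[R] S.X₃) (hp : Function.Surjective p)
    (ex : Function.Exact S.f.hom p) (hip : i ∘ₗ p = S.g.hom) :
    Nonempty (S.homology ≅ ModuleCat.of R (LinearMap.ker i)) := by
  have hip' : ∀ x, i (p x) = S.g.hom x := fun x => by rw [← hip]; rfl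
  let γ : LinearMap.ker S.g.hom →ₗ[R] LinearMap.ker i :=
    LinearMap.codRestrict _ (p ∘ₗ Submodule.subtype _) (by
      rintro ⟨x, hx⟩
      show i (p x) = 0
      rw [hip']; exact hx)
  have hγ : Function.Surjective γ := by
    rintro ⟨t, ht⟩
    obtain ⟨s, rfl⟩ := hp t
    exact ⟨⟨s, by rw [LinearMap.mem_ker, ← hip']; exact ht⟩, rfl⟩
  have hk : LinearMap.range S.moduleCatToCycles = LinearMap.ker γ := by
    ext ⟨x, hx⟩
    rw [LinearMap.mem_ker, Subtype.ext_iff]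
    constructor
    · rintro ⟨y, hy⟩
      have hy' := congrArg Subtype.val hy
      change S.f.hom y = x at hy'
      show p x = 0
      rw [← hy']; exact ex.apply_apply_eq_zero _
    · intro h
      change p x = 0 at h
      obtain ⟨y, hy⟩ := (ex _).1 h
      exact ⟨y, Subtype.ext hy⟩
  let e4 : S.moduleCatLeftHomologyData.H ≅ ModuleCat.of R (LinearMap.ker i) :=
    LinearEquiv.toModuleIso (Submodule.quotEquivOfEq _ _ hk ≪≫ₗ γ.quotKerEquivOfSurjective hγ)
  exact ⟨S.moduleCatHomologyIso ≪≫ e4⟩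

theorem lTensor_fact {A X Y C : Type u} [AddCommGroup A] [AddCommGroup X] [AddCommGroup Y]
    [AddCommGroup C] [Module R A] [Module R X] [Module R Y] [Module R C] (i : C →ₗ[R] Y)
    (p : X →ₗ[R] C) (d : X →ₗ[R] Y) (h : i ∘ₗ p = d) :
    LinearMap.lTensor A i ∘ₗ LinearMap.lTensor A p = LinearMap.lTensor A d := by
  rw [← h, LinearMap.lTensor_comp]

theorem tor_succ {B : ModuleCat.{u} R} (P : ProjectiveResolution B) (A : ModuleCat.{u} R) (k : ℕ) :
    Nonempty (((Tor (ModuleCat.{u} R) (k+1)).obj A).obj B ≅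
      ModuleCat.of R (LinearMap.ker (LinearMap.lTensor A ((resTower P).i k)))) := by
  let F := (tensoringLeft (ModuleCat.{u} R)).obj A
  let K := (F.mapHomologicalComplex (ComplexShape.down ℕ)).obj P.complex
  let e1 : ((Tor (ModuleCat.{u} R) (k+1)).obj A).obj B ≅ K.homology (k+1) :=
    P.isoLeftDerivedObj F (k+1)
  let S := K.sc' (k+2) (k+1) k
  let e2 : K.homology (k+1) ≅ S.homology :=
    ShortComplex.homologyMapIso (K.isoSc' (k+2) (k+1) k (by simp) (by simp))
  have hsurj := LinearMap.lTensor_surjective A (Submodule.mkQ_surjective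
    (LinearMap.range (P.complex.d (k+2) (k+1)).hom))
  have hex : Function.Exact (LinearMap.lTensor A (P.complex.d (k+2) (k+1)).hom)
      (LinearMap.lTensor A (LinearMap.range (P.complex.d (k+2) (k+1)).hom).mkQ) := by
    refine lTensor_exact _ ?_ (Submodule.mkQ_surjective _)
    rw [LinearMap.exact_iff]
    exact Submodule.ker_mkQ _
  obtain ⟨e3⟩ := sc_homology S (LinearMap.lTensor A (LinearMap.range (P.complex.d (k+2) (k+1)).hom).mkQ)
    (LinearMap.lTensor A ((resTower P).i k)) hsurj hex
    (lTensor_fact (A := A) _ _ (P.complex.d (k+1) k).hom (Submodule.liftQ_mkQ _ _ _))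
  exact ⟨e1 ≪≫ e2 ≪≫ e3⟩

theorem tor_zero' (A B : ModuleCat.{u} R) :
    Nonempty (((Tor (ModuleCat.{u} R) 0).obj A).obj B ≅ ModuleCat.of R (A ⊗[R] B)) := by
  have : Limits.PreservesFiniteColimits ((tensoringLeft (ModuleCat.{u} R)).obj A) :=
    inferInstanceAs (Limits.PreservesFiniteColimits (tensorLeft A))
  exact ⟨(((tensoringLeft (ModuleCat.{u} R)).obj A).leftDerivedZeroIsoSelf).app B⟩

end TorContact

section Theta
open TensorProduct

variable {R : Type u} [CommRing R] (D E : Type u) [AddCommGroup D] [Module R D]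
  [AddCommGroup E] [Module R E]

noncomputable def thetaMap (M : Type u) [AddCommGroup M] [Module R M] :
    M ⊗[R] (D →ₗ[R] E) →ₗ[R] ((M →ₗ[R] D) →ₗ[R] E) :=
  TensorProduct.lift (LinearMap.mk₂ R (fun m y => y ∘ₗ LinearMap.applyₗ m)
    (by intros; ext; simp) (by intros; ext; simp) (by intros; ext; simp) (by intros; ext; simp))

theorem thetaMap_tmul (M : Type u) [AddCommGroup M] [Module R M] (m : M) (y : D →ₗ[R] E)
    (f : M →ₗ[R] D) : thetaMap D E M (m ⊗ₜ y) f = y (f m) := rfl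

theorem thetaMap_nat {M N : Type u} [AddCommGroup M] [Module R M] [AddCommGroup N] [Module R N]
    (a : M →ₗ[R] N) (t : M ⊗[R] (D →ₗ[R] E)) (f : N →ₗ[R] D) :
    thetaMap D E N (LinearMap.rTensor _ a t) f = thetaMap D E M t (f ∘ₗ a) := by
  induction t with
  | zero => simp
  | add x y hx hy => simp only [map_add, LinearMap.add_apply, hx, hy]
  | tmul m y => rfl

noncomputable def coordIn (n : ℕ) (j : Fin n) : D →ₗ[R] ((Fin n → R) →ₗ[R] D) :=
  LinearMap.smulRightₗ (LinearMap.proj j)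

theorem theta_free (n : ℕ) : Function.Bijective (thetaMap (R := R) D E (Fin n → R)) := by
  let ψ : (((Fin n → R) →ₗ[R] D) →ₗ[R] E) → (Fin n → R) ⊗[R] (D →ₗ[R] E) := fun φ => 
    ∑ j, (Pi.single j (1 : R) : Fin n → R) ⊗ₜ (φ ∘ₗ coordIn D n j)
  refine Function.bijective_iff_has_inverse.2 ⟨ψ, ?_, ?_⟩
  · intro t
    induction t with
    | zero => simp [ψ]
    | add x y hx hy =>
      have : ψ (thetaMap D E (Fin n → R) (x + y)) = ψ (thetaMap D E (Fin n → R) x) +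
        ψ (thetaMap D E (Fin n → R) y) := by
        simp only [ψ, map_add, LinearMap.add_comp, TensorProduct.tmul_add, Finset.sum_add_distrib]
      rw [this, hx, hy]
    | tmul m y =>
      have : ∀ j, (thetaMap D E (Fin n → R) (m ⊗ₜ y)) ∘ₗ coordIn D n j = m j • y := by
        intro j
        ext d
        rw [LinearMap.comp_apply, thetaMap_tmul]
        simp [coordIn]
      have h2 : ∀ j, (Pi.single j (1 : R) : Fin n → R) ⊗ₜ[R] (m j • y) =
          (m j • (Pi.single j (1 : R) : Fin n → R)) ⊗ₜ[R] y := fun j =>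
        (TensorProduct.smul_tmul _ _ _).symm
      simp only [ψ, this, h2]
      rw [← TensorProduct.sum_tmul, ← pi_eq_sum_univ' m]
  · intro φ
    ext f
    have hf : f = ∑ j, coordIn D n j (f (Pi.single j 1)) := by
      ext j
      simp [coordIn, Pi.single_apply, ite_smul]
    simp only [ψ, map_sum, LinearMap.sum_apply, thetaMap_tmul, LinearMap.comp_apply]
    rw [← map_sum, ← hf]

variable {E}
theorem theta_surj (hE : Module.Injective R E) (M : Type u) [AddCommGroup M] [Module R M]
    [Module.Finite R M] : Function.Surjective (thetaMap (R := R) D E M) := by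
  obtain ⟨n, p, hp⟩ := Module.Finite.exists_fin' R M
  intro φ
  have hinj : Function.Injective (LinearMap.lcomp R D p) := by
    intro f g h
    ext x
    obtain ⟨y, rfl⟩ := hp x
    exact LinearMap.congr_fun h y
  obtain ⟨h, hh⟩ := hE.out _ hinj φ
  obtain ⟨t, ht⟩ := (theta_free D E n).2 h
  refine ⟨LinearMap.rTensor _ p t, ?_⟩
  ext f
  rw [thetaMap_nat, ht]
  exact hh f

theorem theta_inj [IsNoetherianRing R] (hE : Module.Injective R E) (M : Type u) [AddCommGroup M]
    [Module R M] [Module.Finite R M] : Function.Injective (thetaMap (R := R) D E M) := by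
  obtain ⟨n, p, hp⟩ := Module.Finite.exists_fin' R M
  rw [injective_iff_map_eq_zero]
  intro t ht
  obtain ⟨s, rfl⟩ := LinearMap.rTensor_surjective (D →ₗ[R] E) hp t
  let K := LinearMap.ker p
  let r : ((Fin n → R) →ₗ[R] D) →ₗ[R] (K →ₗ[R] D) := LinearMap.lcomp R D K.subtype
  -- functional on the range of r
  have hker : LinearMap.ker r ≤ LinearMap.ker (thetaMap D E _ s) := by
    intro f hf
    have hf' : K ≤ LinearMap.ker f := fun x hx => LinearMap.congr_fun hf ⟨x, hx⟩
    obtain ⟨g, hg⟩ : ∃ g : M →ₗ[R] D, g ∘ₗ p = f := by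
      refine ⟨(K.liftQ f hf') ∘ₗ (p.quotKerEquivOfSurjective hp).symm.toLinearMap, ?_⟩
      refine LinearMap.ext fun x => ?_
      have : (p.quotKerEquivOfSurjective hp).symm (p x) = K.mkQ x := by
        rw [LinearEquiv.symm_apply_eq]; rfl
      show K.liftQ f hf' ((p.quotKerEquivOfSurjective hp).symm (p x)) = f x
      rw [this]; rfl
    rw [LinearMap.mem_ker, ← hg, ← thetaMap_nat, ht]; rfl
  let q := Submodule.liftQ _ (thetaMap D E _ s) hker
  let ι := Submodule.liftQ (LinearMap.ker r) r le_rfl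
  have hι : Function.Injective ι := by
    rw [← LinearMap.ker_eq_bot]; exact Submodule.ker_liftQ_eq_bot _ _ _ le_rfl
  obtain ⟨φ, hφ⟩ := hE.out ι hι q
  obtain ⟨w, hw⟩ := theta_surj D hE K φ
  have : LinearMap.rTensor _ K.subtype w = s := by
    apply (theta_free D E n).1
    ext1 f
    rw [thetaMap_nat, hw]
    exact hφ (Submodule.Quotient.mk f)
  rw [← this, ← LinearMap.comp_apply, ← LinearMap.rTensor_comp]
  have h0 : p ∘ₗ K.subtype = 0 := by ext x; exact x.2
  rw [h0]; simp

noncomputable def evMap (N : Type u) [AddCommGroup N] [Module R N] : D ⊗[R] (D →ₗ[R] N) →ₗ[R] N :=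
  TensorProduct.lift (LinearMap.applyₗ)

theorem evMap_tmul (N : Type u) [AddCommGroup N] [Module R N] (d : D) (f : D →ₗ[R] N) :
  evMap D N (d ⊗ₜ f) = f d := rfl

theorem evMap_nat {N N' : Type u} [AddCommGroup N] [Module R N] [AddCommGroup N'] [Module R N']
    (a : N →ₗ[R] N') (t : D ⊗[R] (D →ₗ[R] N)) :
    evMap D N' (LinearMap.lTensor D (LinearMap.compRight R a) t) = a (evMap D N t) := by
  induction t with
  | zero => simp
  | add x y hx hy => simp only [map_add, hx, hy]
  | tmul m y => rfl

theorem evMap_bij [IsNoetherianRing R] [Module.Finite R D]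
    (hD : Function.Bijective (fun r : R => (r • (LinearMap.id : D →ₗ[R] D))))
    (hE : Module.Injective R E) : Function.Bijective (evMap (R := R) D E) := by
  have key : ∀ t : D ⊗[R] (D →ₗ[R] E), evMap D E t = thetaMap D E D t LinearMap.id := by
    intro t
    induction t with
    | zero => simp
    | add x y hx hy => simp only [map_add, LinearMap.add_apply, hx, hy]
    | tmul m y => rfl
  let μ : R →ₗ[R] (D →ₗ[R] D) := LinearMap.toSpanSingleton R _ LinearMap.id
  let e : R ≃ₗ[R] (D →ₗ[R] D) := LinearEquiv.ofBijective μ hD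
  constructor
  · rw [injective_iff_map_eq_zero]
    intro t ht
    rw [key] at ht
    apply theta_inj D hE D
    rw [map_zero]
    ext1 f
    obtain ⟨r, rfl⟩ := e.surjective f
    show thetaMap D E D t (r • LinearMap.id) = 0
    rw [map_smul, ht, smul_zero]
  · intro x
    obtain ⟨t, ht⟩ := theta_surj D hE D ((LinearMap.toSpanSingleton R E x) ∘ₗ e.symm.toLinearMap)
    refine ⟨t, ?_⟩
    rw [key, ht]
    have : e.symm LinearMap.id = 1 := by
      rw [LinearEquiv.symm_apply_eq]
      show _ = (1:R) • LinearMap.id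
      simp
    simp [this]

end Theta

section ExtBridge
variable {R : Type u} [CommRing R]

theorem ext_bridge (M N : ModuleCat.{u} R) (i : ℕ)
    (h : Limits.IsZero (((Ext R (ModuleCat.{u} R) (i+1)).obj (Opposite.op M)).obj N))
    (α : Abelian.Ext M N (i+1)) : α = 0 := by
  let P := projectiveResolution M
  have h1 := (Limits.IsZero.of_iso h (P.isoExt (R := R) (i+1) N).symm)
  rw [← HomologicalComplex.exactAt_iff_isZero_homology,
    HomologicalComplex.exactAt_iff' _ i (i+1) (i+2) (by simp) (by simp),
    ShortComplex.moduleCat_exact_iff] at h1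
  obtain ⟨f, hf, rfl⟩ := P.extMk_surjective α (i+2) rfl
  rw [P.extMk_eq_zero_iff f (i+2) rfl hf i rfl]
  obtain ⟨g, hg⟩ := h1 f hf
  exact ⟨g, hg⟩

/-- All positive Ext groups vanish. -/
def ExtVan (M N : Type u) [AddCommGroup M] [Module R M] [AddCommGroup N] [Module R N] : Prop :=
  ∀ (i : ℕ) (α : Abelian.Ext (ModuleCat.of R M) (ModuleCat.of R N) (i+1)), α = 0

def mkSC {A' A A'' : Type u} [AddCommGroup A] [AddCommGroup A']
    [AddCommGroup A''] [Module R A] [Module R A'] [Module R A'']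
    (f : A' →ₗ[R] A) (g : A →ₗ[R] A'') (hfg : Function.Exact f g) :
    ShortComplex (ModuleCat.{u} R) :=
  ShortComplex.mk (ModuleCat.ofHom f) (ModuleCat.ofHom g) (by
    ext x; exact hfg.apply_apply_eq_zero x)

theorem mkSC_exact {A' A A'' : Type u} [AddCommGroup A] [AddCommGroup A']
    [AddCommGroup A''] [Module R A] [Module R A'] [Module R A'']
    (f : A' →ₗ[R] A) (g : A →ₗ[R] A'') (hf : Function.Injective f) (hg : Function.Surjective g)
    (hfg : Function.Exact f g) : (mkSC f g hfg).ShortExact where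
  exact := (ShortComplex.ShortExact.moduleCat_exact_iff_function_exact _).2 hfg
  mono_f := (ModuleCat.mono_iff_injective _).2 hf
  epi_g := (ModuleCat.epi_iff_surjective _).2 hg

theorem extVan_syz {A' A A'' N : Type u} [AddCommGroup A] [AddCommGroup A']
    [AddCommGroup A''] [Module R A] [Module R A'] [Module R A''] [AddCommGroup N] [Module R N]
    [Module.Projective R A]
    (f : A' →ₗ[R] A) (g : A →ₗ[R] A'') (hf : Function.Injective f) (hg : Function.Surjective g)
    (hfg : Function.Exact f g) (h : ExtVan (R := R) A'' N) :
    ExtVan (R := R) A' N ∧ ∀ φ : A' →ₗ[R] N, ∃ ψ : A →ₗ[R] N, ψ ∘ₗ f = φ := by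
  have hS := mkSC_exact f g hf hg hfg
  have hP : Projective (ModuleCat.of R A) := (IsProjective.iff_projective _).1 inferInstance
  constructor
  · intro i α
    have h0 := h (i+1) (hS.extClass.comp α (by omega))
    obtain ⟨x₂, hx⟩ := Abelian.Ext.contravariant_sequence_exact₁ hS (ModuleCat.of R N) α
      (by omega) h0
    have : x₂ = 0 := Abelian.Ext.eq_zero_of_projective (P := ModuleCat.of R A) x₂
    rw [← hx, this, Abelian.Ext.comp_zero]; rfl
  · intro φ
    have h0 := h 0 (hS.extClass.comp (Abelian.Ext.mk₀ (ModuleCat.ofHom φ)) (by omega))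
    obtain ⟨x₂, hx⟩ := Abelian.Ext.contravariant_sequence_exact₁ hS (ModuleCat.of R N)
      (Abelian.Ext.mk₀ (ModuleCat.ofHom φ)) (by omega) h0
    obtain ⟨ψ, rfl⟩ := (Abelian.Ext.mk₀_bijective _ _).2 x₂
    rw [Abelian.Ext.mk₀_comp_mk₀] at hx
    have h3 := (Abelian.Ext.mk₀_bijective _ _).1 hx
    exact ⟨ψ.hom, congrArg ModuleCat.Hom.hom h3⟩

end ExtBridge

section StepA
open TensorProduct
variable {R : Type u} [CommRing R]

theorem fin_cover [IsNoetherianRing R] (M : Type u) [AddCommGroup M] [Module R M]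
    [Module.Finite R M] : ∃ (L K : ModuleCat.{u} R) (f : K →ₗ[R] L) (p : L →ₗ[R] M),
    Module.Finite R K ∧ Module.Projective R L ∧ Function.Injective f ∧ Function.Surjective p ∧
    Function.Exact f p := by
  obtain ⟨m, p, hp⟩ := Module.Finite.exists_fin' R M
  exact ⟨ModuleCat.of R (Fin m → R), ModuleCat.of R (LinearMap.ker p), (LinearMap.ker p).subtype,
    p, inferInstanceAs (Module.Finite R (LinearMap.ker p)),
    inferInstanceAs (Module.Projective R (Fin m → R)),
    (LinearMap.ker p).injective_subtype, hp, LinearMap.exact_subtype_ker_map p⟩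

theorem stepA [IsNoetherianRing R] (D E : Type u) [AddCommGroup D] [Module R D]
    [AddCommGroup E] [Module R E] (hE : Module.Injective R E) (T : FTower R)
    (e : T.B 0 ≃ₗ[R] (D →ₗ[R] E)) (n : ℕ) : ∀ (M : Type u) [AddCommGroup M] [Module R M]
    [Module.Finite R M] (_ : ExtVan (R := R) M D),
    Function.Injective (LinearMap.lTensor M (T.i n)) := by
  induction n with
  | zero =>
    intro M _ _ _ hM
    obtain ⟨L, K, f, p, hK, hL, hf, hp, hex⟩ := fin_cover (R := R) M
    obtain ⟨-, h2⟩ := extVan_syz f p hf hp hex hM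
    obtain ⟨s⟩ := ker_snake T 0 f p hf hp hex
      (Module.Flat.lTensor_preserves_injective_linearMap _ (T.inj 0))
    refine inj_of_ker_equiv s ?_
    have h3 : Function.Injective (LinearMap.rTensor (D →ₗ[R] E) f) := by
      rw [injective_iff_map_eq_zero]
      intro t ht
      apply theta_inj D hE K
      rw [map_zero]
      ext1 φ
      obtain ⟨ψ, rfl⟩ := h2 φ
      rw [← thetaMap_nat, ht]; simp
    obtain ⟨e'⟩ := ker_equiv_of_square (LinearMap.rTensor (T.B 0) f)
      (LinearMap.rTensor (D →ₗ[R] E) f) (e.lTensor _) (e.lTensor _) (by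
        apply TensorProduct.ext'
        intro a b
        simp)
    exact inj_of_ker_equiv e' h3
  | succ n ih =>
    intro M _ _ _ hM
    obtain ⟨L, K, f, p, hK, hL, hf, hp, hex⟩ := fin_cover (R := R) M
    obtain ⟨h1, -⟩ := extVan_syz f p hf hp hex hM
    obtain ⟨s⟩ := ker_shift T n f p hf hp hex
      (Module.Flat.lTensor_preserves_injective_linearMap _ (T.inj n))
      (Module.Flat.lTensor_preserves_injective_linearMap _ (T.inj (n+1)))
    exact inj_of_ker_equiv s (ih K h1)

end StepA

section StepP
variable {R : Type u} [CommRing R]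

/-- The lifting property against an acyclic complex. -/
def LiftP {G : Type u} [AddCommGroup G] [Module R G] (T : GorensteinInjData R G) (M : Type u)
    [AddCommGroup M] [Module R M] : Prop :=
  letI := T.acg
  letI := T.mod
  ∀ (i : ℤ) (g : M →ₗ[R] T.E (i + 1)), (T.d i).comp g = 0 →
    ∃ f : M →ₗ[R] T.E (i + 1 + 1), (T.d (i + 1)).comp f = g

theorem liftP_of_ses {G : Type u} [AddCommGroup G] [Module R G] (T : GorensteinInjData R G)
    {A B C : Type u} [AddCommGroup A] [AddCommGroup B] [AddCommGroup C] [Module R A] [Module R B]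
    [Module R C] (ι : A →ₗ[R] B) (π : B →ₗ[R] C) (hι : Function.Injective ι)
    (hπ : Function.Surjective π) (hex : Function.Exact ι π) (hB : LiftP T B) (hC : LiftP T C) :
    LiftP T A := by
  letI := T.acg
  letI := T.mod
  intro i a ha
  obtain ⟨j, rfl⟩ : ∃ j, i = j + 1 := ⟨i - 1, by ring⟩
  obtain ⟨b, hb⟩ := (T.inj (j + 1 + 1)).out ι hι a
  have hker : LinearMap.ker π ≤ LinearMap.ker (T.d (j+1) ∘ₗ b) := by
    intro x hx
    obtain ⟨y, rfl⟩ := (hex x).1 hx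
    show T.d (j+1) (b (ι y)) = 0
    rw [hb]
    exact LinearMap.congr_fun ha y
  obtain ⟨c, hc⟩ : ∃ c : C →ₗ[R] T.E (j+1), c ∘ₗ π = T.d (j+1) ∘ₗ b := by
    refine ⟨(Submodule.liftQ _ _ hker) ∘ₗ (π.quotKerEquivOfSurjective hπ).symm.toLinearMap, ?_⟩
    refine LinearMap.ext fun x => ?_
    have : (π.quotKerEquivOfSurjective hπ).symm (π x) = (LinearMap.ker π).mkQ x := by
      rw [LinearEquiv.symm_apply_eq]; rfl
    show Submodule.liftQ _ _ hker ((π.quotKerEquivOfSurjective hπ).symm (π x)) = _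
    rw [this]; rfl
  have hdd : ∀ x, T.d j (T.d (j+1) x) = 0 := by
    intro x
    have : T.d (j+1) x ∈ LinearMap.ker (T.d j) := by rw [← T.exact j]; exact ⟨x, rfl⟩
    exact this
  have hdc : (T.d j).comp c = 0 := by
    ext x
    obtain ⟨y, rfl⟩ := hπ x
    show T.d j (c (π y)) = 0
    rw [← LinearMap.comp_apply c π, hc]
    exact hdd _
  obtain ⟨c', hc'⟩ := hC j c hdc
  obtain ⟨b', hb'⟩ := hB (j+1) (b - c' ∘ₗ π) (by
    rw [LinearMap.comp_sub, ← LinearMap.comp_assoc, hc', hc, sub_self])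
  refine ⟨b' ∘ₗ ι, ?_⟩
  rw [← LinearMap.comp_assoc, hb']
  ext x
  show b (ι x) - c' (π (ι x)) = a x
  rw [hb, hex.apply_apply_eq_zero, map_zero, sub_zero]

theorem liftP_of_dim {G : Type u} [AddCommGroup G] [Module R G] (T : GorensteinInjData R G)
    (n : ℕ) : ∀ (M : ModuleCat.{u} R) (_ : HasInjectiveDimensionLT M (n+1)), LiftP T M := by
  have hinj : ∀ (M : ModuleCat.{u} R), Injective M → LiftP T M := by
    intro M hM i g hg
    have hM' : Module.Injective R M := (Module.injective_iff_injective_object R M).2 hM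
    letI := T.acg
    letI := T.mod
    exact (T.homExact M hM' i g).1 hg
  induction n with
  | zero =>
    intro M hM
    exact hinj M (injective_iff_hasInjectiveDimensionLT_one.2 hM)
  | succ n ih =>
    intro M hM
    let I := Injective.under M
    let f : M →ₗ[R] I := (Injective.ι M).hom
    have hf : Function.Injective f := (ModuleCat.mono_iff_injective (Injective.ι M)).1 inferInstance
    let g := (LinearMap.range f).mkQ
    have hg : Function.Surjective g := Submodule.mkQ_surjective _
    have hex : Function.Exact f g := by
      rw [LinearMap.exact_iff]; exact Submodule.ker_mkQ _
    have hS := mkSC_exact f g hf hg hex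
    have hI : HasInjectiveDimensionLT I 1 := injective_iff_hasInjectiveDimensionLT_one.1 inferInstance
    have hI' : HasInjectiveDimensionLT I (n+1) := hasInjectiveDimensionLT_of_ge I 1 (n+1) (by omega)
    have h3 := hS.hasInjectiveDimensionLT_X₃ (n+1) hI' hM
    exact liftP_of_ses T f g hf hg hex (hinj I inferInstance) (ih _ h3)

theorem liftP_dualizing {G : Type u} [AddCommGroup G] [Module R G] (T : GorensteinInjData R G)
    (D : Type u) [AddCommGroup D] [Module R D] (hD : IsDualizingModule R D) : LiftP T D := by
  obtain ⟨-, ⟨n, hn⟩, -, -⟩ := hD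
  refine liftP_of_dim T n (ModuleCat.of R D) (HasInjectiveDimensionLT.mk ?_)
  intro i hi Y α
  obtain ⟨i, rfl⟩ : ∃ j, i = j + 1 := ⟨i - 1, by omega⟩
  exact ext_bridge _ _ i (hn Y _ _ (i+1) (by omega)) α

end StepP

section StepB
open TensorProduct
variable {R : Type u} [CommRing R] [IsNoetherianRing R]

theorem stepB_ev (D : Type u) [AddCommGroup D] [Module R D] [Module.Finite R D]
    (hD : Function.Bijective (fun r : R => (r • (LinearMap.id : D →ₗ[R] D))))
    (Z I : ℤ → ModuleCat.{u} R) (f : ∀ j, Z (j+1) →ₗ[R] I j) (g : ∀ j, I j →ₗ[R] Z j)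
    (hf : ∀ j, Function.Injective (f j)) (hg : ∀ j, Function.Surjective (g j))
    (hex : ∀ j, Function.Exact (f j) (g j)) (hI : ∀ j, Module.Injective R (I j))
    (hl : ∀ j, Function.Surjective (LinearMap.compRight R (g j) : (D →ₗ[R] I j) →ₗ[R] _)) (j : ℤ) :
    Function.Bijective (evMap (R := R) D (Z j)) := by
  have hs : ∀ j, Function.Surjective (evMap (R := R) D (Z j)) := by
    intro j x
    obtain ⟨y, rfl⟩ := hg j x
    obtain ⟨t, rfl⟩ := (evMap_bij D hD (hI j)).2 y
    exact ⟨_, evMap_nat D (g j) t⟩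
  refine ⟨?_, hs j⟩
  rw [injective_iff_map_eq_zero]
  intro t ht
  obtain ⟨s, rfl⟩ := LinearMap.lTensor_surjective D (hl j) t
  rw [evMap_nat] at ht
  obtain ⟨z, hz⟩ := (hex j _).1 ht
  obtain ⟨w, rfl⟩ := hs (j+1) z
  rw [← evMap_nat] at hz
  rw [← (evMap_bij D hD (hI j)).1 hz, ← LinearMap.comp_apply, ← LinearMap.lTensor_comp]
  have h0 : (LinearMap.compRight R (g j) : (D →ₗ[R] I j) →ₗ[R] _) ∘ₗ LinearMap.compRight R (f j) = 0 := by
    ext φ d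
    exact (hex j).apply_apply_eq_zero _
  rw [h0]; simp

theorem stepB_hI (D E : Type u) [AddCommGroup D] [Module R D] [Module.Finite R D]
    (hDD : ExtVan (R := R) D D) [AddCommGroup E] [Module R E] (hE : Module.Injective R E)
    (T : FTower R) (e : T.B 0 ≃ₗ[R] D) (n : ℕ) :
    Function.Injective (LinearMap.lTensor (D →ₗ[R] E) (T.i n)) := by
  let P := projectiveResolution (ModuleCat.of R (D →ₗ[R] E))
  obtain ⟨e0⟩ := resTower_zero P
  have h := stepA D E hE (resTower P) e0 n D hDD
  obtain ⟨e1⟩ := lTensor_inj_congr e ((resTower P).i n)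
  have h2 := tower_vanish_symm T (resTower P) n (inj_of_ker_equiv e1 h)
  obtain ⟨e2⟩ := lTensor_inj_congr e0 (T.i n)
  exact inj_of_ker_equiv e2.symm h2

theorem stepB_van (D : Type u) [AddCommGroup D] [Module R D] [Module.Finite R D]
    (hD : Function.Bijective (fun r : R => (r • (LinearMap.id : D →ₗ[R] D))))
    (hDD : ExtVan (R := R) D D)
    (Z I : ℤ → ModuleCat.{u} R) (f : ∀ j, Z (j+1) →ₗ[R] I j) (g : ∀ j, I j →ₗ[R] Z j)
    (hf : ∀ j, Function.Injective (f j)) (hg : ∀ j, Function.Surjective (g j))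
    (hex : ∀ j, Function.Exact (f j) (g j)) (hI : ∀ j, Module.Injective R (I j))
    (hl : ∀ j, Function.Surjective (LinearMap.compRight R (g j) : (D →ₗ[R] I j) →ₗ[R] _))
    (T : FTower R) (e : T.B 0 ≃ₗ[R] D) (n : ℕ) : ∀ (j : ℤ),
    Function.Injective (LinearMap.lTensor (D →ₗ[R] Z j) (T.i n)) := by
  have hfi : ∀ j, Function.Injective
      (LinearMap.compRight R (f j) : (D →ₗ[R] Z (j+1)) →ₗ[R] (D →ₗ[R] I j)) := by
    intro j a b h
    ext d
    exact hf j (LinearMap.congr_fun h d)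
  have hexi : ∀ j, Function.Exact
      (LinearMap.compRight R (f j) : (D →ₗ[R] Z (j+1)) →ₗ[R] (D →ₗ[R] I j))
      (LinearMap.compRight R (g j) : (D →ₗ[R] I j) →ₗ[R] _) := by
    intro j φ
    constructor
    · intro h
      have h' : ∀ d, φ d ∈ LinearMap.range (f j) := fun d =>
        (hex j _).1 (LinearMap.congr_fun h d)
      let e := LinearEquiv.ofInjective (f j) (hf j)
      refine ⟨e.symm.toLinearMap ∘ₗ LinearMap.codRestrict _ φ h', ?_⟩
      ext d
      show f j (e.symm (⟨φ d, h' d⟩)) = φ d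
      exact congrArg Subtype.val (e.apply_symm_apply ⟨φ d, h' d⟩)
    · rintro ⟨ψ, rfl⟩
      ext d
      exact (hex j).apply_apply_eq_zero _
  induction n with
  | zero =>
    intro j
    obtain ⟨s⟩ := ker_snake T 0 _ _ (hfi j) (hl j) (hexi j) (stepB_hI D (I j) hDD (hI j) T e 0)
    refine inj_of_ker_equiv s ?_
    have h3 : Function.Injective (LinearMap.lTensor D
        (LinearMap.compRight R (f j) : (D →ₗ[R] Z (j+1)) →ₗ[R] (D →ₗ[R] I j))) := by
      rw [injective_iff_map_eq_zero]
      intro t ht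
      apply (stepB_ev D hD Z I f g hf hg hex hI hl (j+1)).1
      apply hf j
      rw [← evMap_nat, ht]; simp
    obtain ⟨e'⟩ := ker_equiv_of_square (LinearMap.rTensor (T.B 0)
        (LinearMap.compRight R (f j) : (D →ₗ[R] Z (j+1)) →ₗ[R] (D →ₗ[R] I j)))
      (LinearMap.lTensor D (LinearMap.compRight R (f j) : (D →ₗ[R] Z (j+1)) →ₗ[R] (D →ₗ[R] I j)))
      (TensorProduct.comm R _ _ ≪≫ₗ e.rTensor _) (TensorProduct.comm R _ _ ≪≫ₗ e.rTensor _) (by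
        apply TensorProduct.ext'
        intro a b
        simp)
    exact inj_of_ker_equiv e' h3
  | succ n ih =>
    intro j
    obtain ⟨s⟩ := ker_shift T n _ _ (hfi j) (hl j) (hexi j) (stepB_hI D (I j) hDD (hI j) T e n)
      (stepB_hI D (I j) hDD (hI j) T e (n+1))
    exact inj_of_ker_equiv s (ih (j+1))

/-- Summary for a Gorenstein injective module. -/
theorem stepB (D : Type u) [AddCommGroup D] [Module R D] (hD : IsDualizingModule R D)
    (G : Type u) [AddCommGroup G] [Module R G] (hG : IsGorensteinInjective R G)
    (X : FTower R) (eX : X.B 0 ≃ₗ[R] (D →ₗ[R] G)) :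
    Nonempty ((D ⊗[R] (D →ₗ[R] G)) ≃ₗ[R] G) ∧
      ∀ n, Function.Injective (LinearMap.lTensor D (X.i n)) := by
  obtain ⟨T⟩ := hG
  letI := T.acg
  letI := T.mod
  have hlift := liftP_dualizing T D hD
  obtain ⟨hfin, -, hbij, hext⟩ := hD
  have hDD : ExtVan (R := R) D D := fun i α => ext_bridge _ _ i (hext (i+1) (by omega)) α
  have hdd : ∀ j x, T.d j (T.d (j+1) x) = 0 := by
    intro j x
    have : T.d (j+1) x ∈ LinearMap.ker (T.d j) := by rw [← T.exact j]; exact ⟨x, rfl⟩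
    exact this
  let Z : ℤ → ModuleCat.{u} R := fun j => ModuleCat.of R (LinearMap.ker (T.d j))
  let I : ℤ → ModuleCat.{u} R := fun j => ModuleCat.of R (T.E (j+1+1))
  let f : ∀ j, Z (j+1) →ₗ[R] I j := fun j => (LinearMap.ker (T.d (j+1))).subtype
  let g : ∀ j, I j →ₗ[R] Z j := fun j => LinearMap.codRestrict _ (T.d (j+1)) (hdd j)
  have hf : ∀ j, Function.Injective (f j) := fun j => Submodule.injective_subtype _
  have hg : ∀ j, Function.Surjective (g j) := by
    rintro j ⟨x, hx⟩
    rw [← T.exact j] at hx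
    obtain ⟨y, rfl⟩ := hx
    exact ⟨y, rfl⟩
  have hex : ∀ j, Function.Exact (f j) (g j) := by
    intro j x
    constructor
    · intro h
      exact ⟨⟨x, congrArg Subtype.val h⟩, rfl⟩
    · rintro ⟨⟨y, hy⟩, rfl⟩
      exact Subtype.ext hy
  have hI : ∀ j, Module.Injective R (I j) := fun j => T.inj (j+1+1)
  have hl : ∀ j, Function.Surjective (LinearMap.compRight R (g j) : (D →ₗ[R] I j) →ₗ[R] _) := by
    intro j φ
    obtain ⟨ψ, hψ⟩ := hlift j ((LinearMap.ker (T.d j)).subtype ∘ₗ φ) (by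
      ext d; exact (φ d).2)
    refine ⟨ψ, ?_⟩
    ext d
    exact LinearMap.congr_fun hψ d
  have hev := stepB_ev D hbij Z I f g hf hg hex hI hl (-1)
  have hvan := fun S e n => stepB_van D hbij hDD Z I f g hf hg hex hI hl S e n (-1)
  let eG : G ≃ₗ[R] Z (-1) := T.equiv
  let eH : (D →ₗ[R] G) ≃ₗ[R] (D →ₗ[R] Z (-1)) := LinearEquiv.congrRight eG
  refine ⟨⟨eH.lTensor D ≪≫ₗ LinearEquiv.ofBijective _ hev ≪≫ₗ eG.symm⟩, ?_⟩
  intro n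
  let P := projectiveResolution (ModuleCat.of R D)
  obtain ⟨e0⟩ := resTower_zero P
  have h := hvan (resTower P) e0 n
  obtain ⟨e1⟩ := lTensor_inj_congr (eX ≪≫ₗ eH) ((resTower P).i n)
  have h2 := tower_vanish_symm X (resTower P) n (inj_of_ker_equiv e1 h)
  obtain ⟨e2⟩ := lTensor_inj_congr e0 (X.i n)
  exact inj_of_ker_equiv e2.symm h2

end StepB

/-- `Tor_k^R(E, Hom_R(D,G)) ≅ Tor_k^R(G, Hom_R(D,E))` for a Gorenstein
injective `G` and injective `E`. -/
theorem tor_hom_dualizing_symmetry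
    {R : Type u} [CommRing R] [IsNoetherianRing R]
    (D : Type u) [AddCommGroup D] [Module R D] (hD : IsDualizingModule R D)
    (G : Type u) [AddCommGroup G] [Module R G] (hG : IsGorensteinInjective R G)
    (E : Type u) [AddCommGroup E] [Module R E] (hE : Module.Injective R E) :
    ∀ k : ℕ, Nonempty (
      ((Tor (ModuleCat.{u} R) k).obj (ModuleCat.of R E)).obj (ModuleCat.of R (D →ₗ[R] G)) ≅
      ((Tor (ModuleCat.{u} R) k).obj (ModuleCat.of R G)).obj (ModuleCat.of R (D →ₗ[R] E))) := by
  classical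
  have hfin := hD.1
  have hDD : ExtVan (R := R) D D := fun i α => ext_bridge _ _ i (hD.2.2.2 (i+1) (by omega)) α
  let PX := projectiveResolution (ModuleCat.of R (D →ₗ[R] G))
  let PY := projectiveResolution (ModuleCat.of R (D →ₗ[R] E))
  obtain ⟨eX⟩ := resTower_zero PX
  obtain ⟨eY⟩ := resTower_zero PY
  obtain ⟨⟨eG⟩, hX⟩ := stepB D hD G hG (resTower PX) eX
  have hY := fun n => stepA D E hE (resTower PY) eY n D hDD
  let eE : TensorProduct R D (D →ₗ[R] E) ≃ₗ[R] E :=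
    LinearEquiv.ofBijective _ (evMap_bij D hD.2.2.1 hE)
  intro k
  cases k with
  | zero =>
    obtain ⟨a⟩ := tor_zero' (ModuleCat.of R E) (ModuleCat.of R (D →ₗ[R] G))
    obtain ⟨b⟩ := tor_zero' (ModuleCat.of R G) (ModuleCat.of R (D →ₗ[R] E))
    let c : TensorProduct R E (D →ₗ[R] G) ≃ₗ[R] TensorProduct R G (D →ₗ[R] E) :=
      eE.symm.rTensor _ ≪≫ₗ TensorProduct.rightComm R D (D →ₗ[R] E) (D →ₗ[R] G) ≪≫ₗ eG.rTensor _
    exact ⟨a ≪≫ c.toModuleIso ≪≫ b.symm⟩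
  | succ k =>
    obtain ⟨a⟩ := tor_succ PX (ModuleCat.of R E) k
    obtain ⟨b⟩ := tor_succ PY (ModuleCat.of R G) k
    obtain ⟨s⟩ := tower_symm D k (resTower PX) (resTower PY) hX hY
    obtain ⟨c1⟩ := lTensor_inj_congr ((eY.lTensor D) ≪≫ₗ eE) ((resTower PX).i k)
    obtain ⟨c2⟩ := lTensor_inj_congr ((eX.lTensor D) ≪≫ₗ eG) ((resTower PY).i k)
    exact ⟨a ≪≫ (c1.symm ≪≫ₗ s ≪≫ₗ c2).toModuleIso ≪≫ b.symm⟩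
end

section
/- Let R be a commutative noetherian ring with a dualizing module, let E be an injective R-module, and let M be a Gorenstein flat R-module. Then the R-module E ⊗_R M is Gorenstein injective. -/
open CategoryTheory

universe u

theorem gi_ext_bridge {R : Type u} [CommRing R] (A D : Type u) [AddCommGroup A] [Module R A]
    [AddCommGroup D] [Module R D] (n : ℕ)
    (h : Limits.IsZero (((Ext R (ModuleCat.{u} R) (n+1)).obj
        (Opposite.op (ModuleCat.of R A))).obj (ModuleCat.of R D))) :
    Subsingleton (Abelian.Ext.{u} (ModuleCat.of R A) (ModuleCat.of R D) (n+1)) := by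
  let P := projectiveResolution (ModuleCat.of R A)
  have h1 := h.of_iso (P.isoExt (R := R) (n+1) (ModuleCat.of R D)).symm
  rw [← HomologicalComplex.exactAt_iff_isZero_homology, HomologicalComplex.exactAt_iff' _ n (n+1) (n+1+1) (by simp) (by simp)] at h1
  rw [ShortComplex.moduleCat_exact_iff] at h1
  refine subsingleton_of_forall_eq 0 fun α => ?_
  obtain ⟨f, hf, rfl⟩ := P.extMk_surjective α (n+1+1) rfl
  rw [P.extMk_eq_zero_iff f _ rfl hf n rfl]
  obtain ⟨g, hg⟩ := h1 f hf
  exact ⟨g, hg⟩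

/-- the vanishing of Ext in a given degree -/
def GiExtV {R : Type u} [CommRing R] (D : Type u) [AddCommGroup D] [Module R D] (n : ℕ)
    (A : Type u) [AddCommGroup A] [Module R A] : Prop :=
  Subsingleton (Abelian.Ext.{u} (ModuleCat.of R A) (ModuleCat.of R D) n)

theorem gi_ext_shift {R : Type u} [CommRing R] {A G D : Type u} [AddCommGroup A] [Module R A]
    [AddCommGroup D] [Module R D] [AddCommGroup G] [Module R G] [Module.Projective R G]
    (p : G →ₗ[R] A) (hp : Function.Surjective p) (n : ℕ)
    (h : GiExtV (R := R) D (n+1) A) (h' : 1 ≤ n) : GiExtV (R := R) D n (LinearMap.ker p) := by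
  have hS := LinearMap.shortExact_shortComplexKer hp
  have : Projective (ModuleCat.of R G) := inferInstance
  unfold GiExtV at *
  obtain ⟨n, rfl⟩ : ∃ m, n = m + 1 := ⟨n-1, by omega⟩
  refine subsingleton_of_forall_eq 0 fun α => ?_
  obtain ⟨x, hx⟩ := Abelian.Ext.contravariant_sequence_exact₁ hS _ α (add_comm _ _) (h.elim _ _)
  have : x = 0 := Abelian.Ext.eq_zero_of_projective (P := ModuleCat.of R G) x
  subst this
  simpa using hx.symm

theorem gi_ext_one {R : Type u} [CommRing R] {A G D : Type u} [AddCommGroup A] [Module R A]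
    [AddCommGroup D] [Module R D] [AddCommGroup G] [Module R G]
    (p : G →ₗ[R] A) (hp : Function.Surjective p)
    (h : GiExtV (R := R) D 1 A) (g : LinearMap.ker p →ₗ[R] D) :
    ∃ f : G →ₗ[R] D, f ∘ₗ (LinearMap.ker p).subtype = g := by
  have hS := LinearMap.shortExact_shortComplexKer hp
  unfold GiExtV at *
  obtain ⟨x, hx⟩ := Abelian.Ext.contravariant_sequence_exact₁ hS (ModuleCat.of R D) (.mk₀ (ModuleCat.ofHom g)) (add_comm _ _) (h.elim _ _)
  obtain ⟨f, rfl⟩ := (Abelian.Ext.mk₀_bijective _ _).2 x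
  rw [Abelian.Ext.mk₀_comp_mk₀] at hx
  have := (Abelian.Ext.mk₀_bijective _ _).1 hx
  exact ⟨f.hom, by
    have := congrArg ModuleCat.Hom.hom this
    exact this⟩

section GiL
variable {R : Type u} [CommRing R] {I : ℤ → Type u} [∀ i, AddCommGroup (I i)]
  [∀ i, Module R (I i)] (d : ∀ i : ℤ, I (i + 1) →ₗ[R] I i)

/-- `Hom(N, I)` is exact. -/
def GiL (N : Type u) [AddCommGroup N] [Module R N] : Prop :=
  ∀ (i : ℤ) (g : N →ₗ[R] I (i + 1)), d i ∘ₗ g = 0 →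
    ∃ f : N →ₗ[R] I (i + 1 + 1), d (i + 1) ∘ₗ f = g

theorem GiL.retract {N N' : Type u} [AddCommGroup N] [Module R N] [AddCommGroup N'] [Module R N']
    (h : GiL d N) (a : N' →ₗ[R] N) (r : N →ₗ[R] N') (hr : r ∘ₗ a = LinearMap.id) : GiL d N' := by
  intro i g hg
  obtain ⟨f, hf⟩ := h i (g ∘ₗ r) (by rw [← LinearMap.comp_assoc, hg, LinearMap.zero_comp])
  refine ⟨f ∘ₗ a, ?_⟩
  rw [← LinearMap.comp_assoc, hf, LinearMap.comp_assoc, hr, LinearMap.comp_id]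

theorem GiL.finsupp {N : Type u} [AddCommGroup N] [Module R N] (h : GiL d N) (ι : Type u) :
    GiL d (ι →₀ N) := by
  intro i g hg
  have := fun j : ι => h i (g ∘ₗ Finsupp.lsingle j)
    (by rw [← LinearMap.comp_assoc, hg, LinearMap.zero_comp])
  choose f hf using this
  refine ⟨Finsupp.lsum ℕ f, ?_⟩
  ext j x
  simpa using LinearMap.congr_fun (hf j) x

theorem GiL.coker (hI : ∀ i, Module.Injective R (I i)) (hd : ∀ i, d i ∘ₗ d (i + 1) = 0)
    {N' N N'' : Type u} [AddCommGroup N] [Module R N]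
    [AddCommGroup N'] [Module R N'] [AddCommGroup N''] [Module R N'']
    (a : N' →ₗ[R] N) (p : N →ₗ[R] N'') (ha : Function.Injective a) (hp : Function.Surjective p)
    (hap : Function.Exact a p) (h' : GiL d N') (h : GiL d N) : GiL d N'' := by
  intro i g hg
  obtain ⟨f, hf⟩ := h i (g ∘ₗ p) (by rw [← LinearMap.comp_assoc, hg, LinearMap.zero_comp])
  obtain ⟨k, hk⟩ := h' (i + 1) (f ∘ₗ a) (by
    rw [← LinearMap.comp_assoc, hf, LinearMap.comp_assoc, hap.linearMap_comp_eq_zero,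
      LinearMap.comp_zero])
  obtain ⟨l, hl⟩ := (hI _).out a ha k
  let f' := f - d (i + 1 + 1) ∘ₗ l
  have hf' : LinearMap.ker p ≤ LinearMap.ker f' := by
    intro x hx
    obtain ⟨y, rfl⟩ := (hap x).1 hx
    have := LinearMap.congr_fun hk y
    simp only [LinearMap.comp_apply] at this
    simp [f', hl, this]
  let e := p.quotKerEquivOfSurjective hp
  refine ⟨(LinearMap.ker p).liftQ f' hf' ∘ₗ e.symm.toLinearMap, ?_⟩
  ext y
  obtain ⟨x, rfl⟩ := hp y
  have h1 : e.symm (p x) = Submodule.Quotient.mk x := by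
    rw [LinearEquiv.symm_apply_eq]; rfl
  have h2 := LinearMap.congr_fun hf x
  have h3 := LinearMap.congr_fun (hd (i+1)) (l x)
  simp only [LinearMap.comp_apply, LinearMap.zero_apply] at h2 h3
  simp only [LinearMap.comp_apply, LinearEquiv.coe_coe, h1, Submodule.liftQ_apply, f',
    LinearMap.sub_apply, map_sub, h2, h3, sub_zero]

theorem GiL.extend (hI : ∀ i, Module.Injective R (I i)) (hd : ∀ i, d i ∘ₗ d (i + 1) = 0)
    {N' N : Type u} [AddCommGroup N] [Module R N] [AddCommGroup N'] [Module R N']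
    (a : N' →ₗ[R] N) (ha : Function.Injective a) (h' : GiL d N') (h : GiL d N)
    (i : ℤ) (g : N →ₗ[R] I (i + 1)) (hg : d i ∘ₗ g = 0) (f' : N' →ₗ[R] I (i + 1 + 1))
    (hf' : d (i + 1) ∘ₗ f' = g ∘ₗ a) :
    ∃ f : N →ₗ[R] I (i + 1 + 1), d (i + 1) ∘ₗ f = g ∧ f ∘ₗ a = f' := by
  obtain ⟨f, hf⟩ := h i g hg
  obtain ⟨k, hk⟩ := h' (i + 1) (f ∘ₗ a - f') (by
    rw [LinearMap.comp_sub, ← LinearMap.comp_assoc, hf, hf', sub_self])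
  obtain ⟨l, hl⟩ := (hI _).out a ha k
  refine ⟨f - d (i + 1 + 1) ∘ₗ l, ?_, ?_⟩
  · rw [LinearMap.comp_sub, ← LinearMap.comp_assoc, hd, hf, LinearMap.zero_comp, sub_zero]
  · have : l ∘ₗ a = k := by ext x; exact hl x
    rw [LinearMap.sub_comp, LinearMap.comp_assoc, this, hk]; abel

/-- union over the finite subsets of a set -/
def giK {Q : Type u} [AddCommGroup Q] [Module R Q] {ι : Type u}
    (K : Finset ι → Submodule R Q) (A : Set ι) : Submodule R Q :=
  ⨆ T : {T : Finset ι // (T : Set ι) ⊆ A}, K T.1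

theorem mem_giK {Q : Type u} [AddCommGroup Q] [Module R Q] {ι : Type u}
    {K : Finset ι → Submodule R Q} (hK : Monotone K) {A : Set ι} {x : Q} :
    x ∈ giK K A ↔ ∃ T : Finset ι, (T : Set ι) ⊆ A ∧ x ∈ K T := by
  classical
  have : Nonempty {T : Finset ι // (T : Set ι) ⊆ A} := ⟨⟨∅, by simp⟩⟩
  unfold giK
  rw [Submodule.mem_iSup_of_directed]
  · simp
  · rintro ⟨S, hS⟩ ⟨T, hT⟩
    exact ⟨⟨S ∪ T, by simp [hS, hT]⟩, hK Finset.subset_union_left, hK Finset.subset_union_right⟩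

theorem giK_mono {Q : Type u} [AddCommGroup Q] [Module R Q] {ι : Type u}
    {K : Finset ι → Submodule R Q} (hK : Monotone K) {A B : Set ι} (h : A ⊆ B) :
    giK K A ≤ giK K B := by
  intro x hx
  rw [mem_giK hK] at hx ⊢
  obtain ⟨T, hT, hx⟩ := hx
  exact ⟨T, hT.trans h, hx⟩

theorem gi_mem_domain_sSup {Q P : Type u} [AddCommGroup Q] [Module R Q] [AddCommGroup P]
    [Module R P] {c : Set (Q →ₗ.[R] P)} (hdir : DirectedOn (· ≤ ·) c) (hne : c.Nonempty) {x : Q} :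
    x ∈ (LinearPMap.sSup c hdir).domain ↔ ∃ p ∈ c, x ∈ p.domain := by
  change x ∈ sSup (LinearPMap.domain '' c) ↔ _
  rw [Submodule.mem_sSup_of_directed]
  · simp only [Set.mem_image, exists_exists_and_eq_and]
  · exact hne.image _
  · rintro _ ⟨a, ha, rfl⟩ _ ⟨b, hb, rfl⟩
    obtain ⟨z, hz, h1, h2⟩ := hdir a ha b hb
    exact ⟨_, ⟨z, hz, rfl⟩, h1.1, h2.1⟩

theorem GiL.giK_step_aux (hI : ∀ i, Module.Injective R (I i)) (hd : ∀ i, d i ∘ₗ d (i + 1) = 0)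
    {Q : Type u} [AddCommGroup Q] [Module R Q] {ι : Type u}
    {K : Finset ι → Submodule R Q} (hK : Monotone K) (A : Set ι) (hA : A.Infinite)
    (W : Type u) [LinearOrder W] [WellFoundedLT W] (e : W ≃ A)
    (hIio : ∀ a : W, Cardinal.mk (Set.Iio a) < Cardinal.mk A)
    (ih : ∀ B : Set ι, Cardinal.mk B < Cardinal.mk A → GiL d (giK K B)) : GiL d (giK K A) := by
  intro i g hg
  have hinf : Cardinal.aleph0 ≤ Cardinal.mk A := by
    rw [Cardinal.aleph0_le_mk_iff]; exact hA.to_subtype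
  obtain ⟨im, him⟩ : ∃ im : Set W → Set ι, ∀ s, im s = (fun w => (e w : ι)) '' s := ⟨_, fun _ => rfl⟩
  have im_sub : ∀ s, im s ⊆ A := by
    intro s; rw [him]; rintro _ ⟨w, _, rfl⟩; exact (e w).2
  have im_mono : ∀ s t, s ⊆ t → im s ⊆ im t := fun s t h => by
    rw [him, him]; exact Set.image_mono h
  let Z : Set (Set W × (Q →ₗ.[R] I (i + 1 + 1))) := {p | IsLowerSet p.1 ∧
    p.2.domain = giK K (im p.1) ∧ ∀ (x : Q) (hx : x ∈ p.2.domain) (hx' : x ∈ giK K A),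
      d (i + 1) (p.2 ⟨x, hx⟩) = g ⟨x, hx'⟩}
  have hZ0 : ∃ p, p ∈ Z := by
    have h0 : GiL d (giK K (im ∅)) := ih _ (by
      rw [him, Set.image_empty, Cardinal.mk_eq_zero]
      exact lt_of_lt_of_le Cardinal.aleph0_pos hinf)
    let inc := Submodule.inclusion (giK_mono hK (im_sub ∅))
    obtain ⟨f, hf⟩ := h0 i (g ∘ₗ inc) (by rw [← LinearMap.comp_assoc, hg, LinearMap.zero_comp])
    refine ⟨(∅, ⟨giK K (im ∅), f⟩), isLowerSet_empty, rfl, ?_⟩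
    intro x hx hx'
    exact LinearMap.congr_fun hf ⟨x, hx⟩
  obtain ⟨p0, hp0⟩ := hZ0
  obtain ⟨m, -, hm⟩ := zorn_le_nonempty₀ Z (by
    intro c hcZ hc y hy
    have hdir : DirectedOn (· ≤ ·) (Prod.snd '' c) := by
      rintro _ ⟨a, ha, rfl⟩ _ ⟨b, hb, rfl⟩
      rcases hc.total ha hb with h | h
      · exact ⟨b.2, ⟨b, hb, rfl⟩, h.2, le_rfl⟩
      · exact ⟨a.2, ⟨a, ha, rfl⟩, le_rfl, h.2⟩
    let F := LinearPMap.sSup (Prod.snd '' c) hdir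
    refine ⟨(⋃ p ∈ c, p.1, F), ⟨?_, ?_, ?_⟩, ?_⟩
    · exact isLowerSet_iUnion₂ fun p hp => (hcZ hp).1
    · ext x
      have hdom : x ∈ F.domain ↔ ∃ p ∈ c, x ∈ p.2.domain := by
        rw [gi_mem_domain_sSup hdir ⟨_, ⟨y, hy, rfl⟩⟩]
        simp only [Set.mem_image, exists_exists_and_eq_and]
      change x ∈ F.domain ↔ _
      rw [hdom]
      constructor
      · rintro ⟨p, hp, hx⟩
        rw [(hcZ hp).2.1] at hx
        have hsub : p.1 ⊆ ⋃ p ∈ c, p.1 :=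
          Set.subset_biUnion_of_mem (u := fun p : Set W × (Q →ₗ.[R] I (i + 1 + 1)) => p.1) hp
        exact giK_mono hK (im_mono _ _ hsub) hx
      · intro hx
        rw [mem_giK hK] at hx
        obtain ⟨T, hT, hx⟩ := hx
        have hT' : (T : Set ι) ⊆ ⋃ p ∈ c, im p.1 := by
          simpa only [him, Set.image_iUnion] using hT
        have : ∃ p ∈ c, (T : Set ι) ⊆ im p.1 := by
          have hd' : DirectedOn (fun p q : Set W × (Q →ₗ.[R] I (i + 1 + 1)) => im p.1 ⊆ im q.1) c := by
            intro a ha b hb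
            rcases hc.total ha hb with h | h
            · exact ⟨b, hb, im_mono _ _ h.1, subset_rfl⟩
            · exact ⟨a, ha, subset_rfl, im_mono _ _ h.1⟩
          exact DirectedOn.exists_mem_subset_of_finset_subset_biUnion ⟨y, hy⟩ hd' hT'
        obtain ⟨p, hp, hTp⟩ := this
        refine ⟨p, hp, ?_⟩
        rw [(hcZ hp).2.1, mem_giK hK]
        exact ⟨T, hTp, hx⟩
    · intro x hx hx'
      have hdom : x ∈ F.domain ↔ ∃ p ∈ c, x ∈ p.2.domain := by
        rw [gi_mem_domain_sSup hdir ⟨_, ⟨y, hy, rfl⟩⟩]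
        simp only [Set.mem_image, exists_exists_and_eq_and]
      obtain ⟨p, hp, hxp⟩ := hdom.1 hx
      have : p.2 ≤ F := LinearPMap.le_sSup hdir ⟨p, hp, rfl⟩
      rw [← (hcZ hp).2.2 x hxp hx']
      congr 1
      exact (this.2 (x := ⟨x, hxp⟩) (y := ⟨x, hx⟩) rfl).symm
    · intro p hp
      exact ⟨Set.subset_biUnion_of_mem (u := fun p : Set W × (Q →ₗ.[R] I (i + 1 + 1)) => p.1) hp,
        LinearPMap.le_sSup hdir ⟨p, hp, rfl⟩⟩) p0 hp0
  obtain ⟨⟨hlow, hdom, hm2⟩, hmax⟩ := hm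
  have hcard : ∀ s : Set W, Cardinal.mk s < Cardinal.mk A → GiL d (giK K (im s)) := by
    intro s hs
    refine ih _ (lt_of_le_of_lt ?_ hs)
    rw [him]; exact Cardinal.mk_image_le
  have huniv : m.1 = Set.univ := by
    by_contra hne
    obtain ⟨a, ha, hamin⟩ := WellFounded.has_min (wellFounded_lt (α := W)) (m.1)ᶜ
      (Set.nonempty_compl.2 hne)
    have hmI : m.1 = Set.Iio a := by
      ext w
      constructor
      · intro hw
        by_contra hwa
        exact ha (hlow (not_lt.1 hwa) hw)
      · intro hw
        by_contra hwm
        exact hamin w hwm hw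
    have hc1 : Cardinal.mk (Set.Iio a) < Cardinal.mk A := hIio a
    have hc2 : Cardinal.mk (insert a (Set.Iio a) : Set W) < Cardinal.mk A := by
      refine lt_of_le_of_lt (Cardinal.mk_insert_le) ?_
      exact Cardinal.add_lt_of_lt hinf hc1 (lt_of_lt_of_le Cardinal.one_lt_aleph0 hinf)
    set s2 : Set W := insert a (Set.Iio a)
    have hsub : m.1 ⊆ s2 := hmI ▸ Set.subset_insert _ _
    have hle : m.2.domain ≤ giK K (im s2) := hdom ▸ giK_mono hK (im_mono _ _ hsub)
    have hL1 : GiL d m.2.domain := by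
      rw [hdom, hmI]; exact hcard _ hc1
    obtain ⟨f, hf1, hf2⟩ := GiL.extend d hI hd (Submodule.inclusion hle)
      (Submodule.inclusion_injective hle) hL1 (hcard _ hc2) i
      (g ∘ₗ Submodule.inclusion (giK_mono hK (im_sub s2)))
      (by rw [← LinearMap.comp_assoc, hg, LinearMap.zero_comp]) m.2.toFun (by
        ext x
        exact hm2 x.1 x.2 _)
    have hmem : ((s2, ⟨giK K (im s2), f⟩) : Set W × (Q →ₗ.[R] I (i + 1 + 1))) ∈ Z := by
      refine ⟨?_, rfl, ?_⟩
      · change IsLowerSet s2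
        have : s2 = Set.Iic a := by ext w; simp [s2, le_iff_eq_or_lt]
        rw [this]; exact isLowerSet_Iic a
      · intro x hx hx'
        exact LinearMap.congr_fun hf1 ⟨x, hx⟩
    have := hmax hmem ⟨hsub, hle, by
      intro x y hxy
      have := LinearMap.congr_fun hf2 x
      have hy : y = Submodule.inclusion hle x := Subtype.ext hxy.symm
      rw [hy]; exact this.symm⟩
    exact ha (this.1 (Set.mem_insert _ _))
  have himA : im m.1 = A := by
    rw [him, huniv]
    ext x
    constructor
    · rintro ⟨w, _, rfl⟩; exact (e w).2
    · intro hx; exact ⟨e.symm ⟨x, hx⟩, trivial, by simp⟩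
  rw [himA] at hdom
  refine ⟨m.2.toFun ∘ₗ Submodule.inclusion hdom.ge, ?_⟩
  ext x
  exact hm2 x.1 _ x.2

theorem GiL.giK_step (hI : ∀ i, Module.Injective R (I i)) (hd : ∀ i, d i ∘ₗ d (i + 1) = 0)
    {Q : Type u} [AddCommGroup Q] [Module R Q] {ι : Type u}
    {K : Finset ι → Submodule R Q} (hK : Monotone K) (A : Set ι) (hA : A.Infinite)
    (ih : ∀ B : Set ι, Cardinal.mk B < Cardinal.mk A → GiL d (giK K B)) : GiL d (giK K A) := by
  have hW : Cardinal.mk (Cardinal.mk A).ord.ToType = Cardinal.mk A := by simp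
  obtain ⟨e⟩ := Cardinal.eq.1 hW
  exact GiL.giK_step_aux d hI hd hK A hA _ e (fun a => Cardinal.mk_Iio_ord_toType a) ih

theorem GiL.giK_all (hI : ∀ i, Module.Injective R (I i)) (hd : ∀ i, d i ∘ₗ d (i + 1) = 0)
    {Q : Type u} [AddCommGroup Q] [Module R Q] {ι : Type u}
    {K : Finset ι → Submodule R Q} (hK : Monotone K) (h : ∀ T, GiL d (K T)) (A : Set ι) :
    GiL d (giK K A) := by
  generalize hc : Cardinal.mk A = c
  induction c using WellFoundedLT.induction generalizing A with
  | ind c ih =>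
    by_cases hA : A.Finite
    · have : giK K A = K hA.toFinset := by
        ext x
        rw [mem_giK hK]
        constructor
        · rintro ⟨T, hT, hx⟩
          exact hK (by simpa using hT) hx
        · intro hx
          exact ⟨_, by simp, hx⟩
      rw [this]; exact h _
    · exact GiL.giK_step d hI hd hK A hA fun B hB => ih _ (hc ▸ hB) B rfl

theorem gi_exists_mono (ι : Type u) [PartialOrder ι] [Nonempty ι] [IsDirectedOrder ι] :
    ∃ v : Finset ι → ι, Monotone v ∧ ∀ i, i ≤ v {i} := by
  classical
  choose ub hub using (Finset.exists_le : ∀ S : Finset ι, _)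
  obtain ⟨v, hv0⟩ : ∃ v : Finset ι → ι, ∀ S, v S = ub (S ∪ S.ssubsets.attach.image
      fun T => v T.1) :=
    ⟨Finset.strongInduction (p := fun _ => ι) (fun S ih =>
      ub (S ∪ S.ssubsets.attach.image fun T => ih T.1 (Finset.mem_ssubsets.1 T.2))),
      fun S => Finset.strongInduction_eq _ _⟩
  have hv : ∀ S, ∀ i ∈ (S ∪ S.ssubsets.attach.image fun T => v T.1), i ≤ v S := by
    intro S i hi
    rw [hv0 S]
    exact hub _ i hi
  refine ⟨v, ?_, ?_⟩
  · intro S T hST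
    rcases eq_or_ssubset_of_subset hST with rfl | h
    · exact le_rfl
    · apply hv T
      simp only [Finset.mem_union, Finset.mem_image]
      exact Or.inr ⟨⟨S, Finset.mem_ssubsets.2 h⟩, by simp, rfl⟩
  · intro i
    exact hv _ _ (by simp)

theorem GiL.directed (hI : ∀ i, Module.Injective R (I i)) (hd : ∀ i, d i ∘ₗ d (i + 1) = 0)
    {Q : Type u} [AddCommGroup Q] [Module R Q] (C : Set (Submodule R Q)) (hne : C.Nonempty)
    (hC : DirectedOn (· ≤ ·) C) (h : ∀ N ∈ C, GiL d N) : GiL d (sSup C : Submodule R Q) := by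
  have : Nonempty C := hne.to_subtype
  have : IsDirectedOrder C := ⟨fun a b => by
    obtain ⟨z, hz, h1, h2⟩ := hC a a.2 b b.2
    exact ⟨⟨z, hz⟩, h1, h2⟩⟩
  obtain ⟨v, hv, hv'⟩ := gi_exists_mono C
  have hK : Monotone fun T : Finset C => (v T : Submodule R Q) := fun S T hST => hv hST
  have := GiL.giK_all d hI hd hK (fun T => h _ (v T).2) Set.univ
  have heq : giK (fun T : Finset C => (v T : Submodule R Q)) Set.univ = sSup C := by
    apply le_antisymm
    · exact iSup_le fun T => le_sSup (v T.1).2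
    · refine sSup_le fun N hN => ?_
      refine le_trans (hv' ⟨N, hN⟩) ?_
      exact le_iSup (fun T : {T : Finset C // (T : Set C) ⊆ Set.univ} => (v T.1 : Submodule R Q)) ⟨{⟨N, hN⟩}, Set.subset_univ _⟩
  rwa [heq] at this
end GiL

section GiFlat
open TensorProduct

theorem gi_lTensor_ker {R : Type u} [CommRing R] (D : Type u) {G L : Type u} [AddCommGroup D]
    [Module R D] [AddCommGroup L] [Module R L] [AddCommGroup G] [Module R G]
    (p : G →ₗ[R] L) (hp : Function.Surjective p) :
    Function.Exact ((LinearMap.ker p).subtype.lTensor D) (p.lTensor D) :=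
  lTensor_exact D (LinearMap.exact_subtype_ker_map p) hp

theorem gi_idem {R : Type u} [CommRing R] {L : Type u} [AddCommGroup L] [Module R L]
    [Module.Flat R L] (K : Submodule R ((L × ℕ) →₀ R)) (hK : K.FG)
    (hKL : K ≤ LinearMap.ker (Finsupp.linearCombination R (Prod.fst : L × ℕ → L))) :
    ∃ θ : ((L × ℕ) →₀ R) →ₗ[R] ((L × ℕ) →₀ R), θ ∘ₗ θ = θ ∧
      (Finsupp.linearCombination R (Prod.fst : L × ℕ → L)) ∘ₗ θ = 0 ∧ (LinearMap.range θ).FG ∧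
        ∀ k ∈ K, θ k = k := by
  classical
  set π := Finsupp.linearCombination R (Prod.fst : L × ℕ → L) with hπ
  have hfin : Module.Finite R K := Module.Finite.iff_fg.2 hK
  obtain ⟨t, ht⟩ := hK
  let S : Finset (L × ℕ) := t.biUnion fun x => x.support
  have hS : K ≤ Finsupp.supported R R (S : Set (L × ℕ)) := by
    rw [← ht, Submodule.span_le]
    intro x hx
    change x ∈ Finsupp.supported R R _
    rw [Finsupp.mem_supported]
    intro p hp
    simp only [S, Finset.coe_biUnion, Set.mem_iUnion]
    exact ⟨x, hx, hp⟩
  let r : ((L × ℕ) →₀ R) →ₗ[R] (S →₀ R) := Finsupp.lsubtypeDomain (fun x => x ∈ S)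
  let emb : (S →₀ R) →ₗ[R] ((L × ℕ) →₀ R) := Finsupp.lmapDomain R R Subtype.val
  have hre : r ∘ₗ emb = LinearMap.id := by
    refine LinearMap.ext fun z => Finsupp.ext fun s => ?_
    change Finsupp.mapDomain Subtype.val z s.1 = z s
    exact Finsupp.mapDomain_apply Subtype.val_injective z s
  have her : ∀ k ∈ K, emb (r k) = k := by
    intro k hk
    have := hS hk
    rw [Finsupp.mem_supported] at this
    ext p
    change Finsupp.mapDomain Subtype.val (Finsupp.subtypeDomain (fun x => x ∈ S) k) p = k p
    by_cases hp : p ∈ S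
    · exact Finsupp.mapDomain_apply Subtype.val_injective _ (⟨p, hp⟩ : S)
    · rw [Finsupp.mapDomain_of_notMem_range]
      · by_contra hne
        exact hp (this (Finsupp.mem_support_iff.2 (Ne.symm hne)))
      · rintro ⟨q, rfl⟩; exact hp q.2
  obtain ⟨n, a, y, h1, h2⟩ := Module.Flat.exists_factorization_of_comp_eq_zero_of_free
    (R := R) (M := L) (K := K) (N := (S →₀ R)) (f := r ∘ₗ K.subtype) (x := π ∘ₗ emb) (by
      ext k
      simp only [LinearMap.comp_apply, Submodule.subtype_apply, her k.1 k.2]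
      exact hKL k.2)
  let n0 := S.sup Prod.snd + 1
  let σ : (Fin n →₀ R) →ₗ[R] ((L × ℕ) →₀ R) :=
    Finsupp.linearCombination R (fun j => Finsupp.single (y (Finsupp.single j 1), n0) 1)
  have hσ : π ∘ₗ σ = y := by
    ext j
    simp [π, σ]
  have hrσ : r ∘ₗ σ = 0 := by
    ext j s
    have : ((y (Finsupp.single j 1), n0) : L × ℕ) ≠ s.1 := by
      intro h
      have h3 : s.1.2 ≤ S.sup Prod.snd := Finset.le_sup (f := Prod.snd) s.2
      have h4 : n0 = s.1.2 := congrArg Prod.snd h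
      have h5 : n0 = S.sup Prod.snd + 1 := rfl
      omega
    have h6 : σ (Finsupp.single j 1) = Finsupp.single (y (Finsupp.single j 1), n0) 1 := by
      simp [σ]
    change (σ (Finsupp.single j 1)) s.1 = 0
    rw [h6, Finsupp.single_apply, if_neg this]
  refine ⟨(emb - σ ∘ₗ a) ∘ₗ r, ?_, ?_, ?_, ?_⟩
  · have : r ∘ₗ (emb - σ ∘ₗ a) = LinearMap.id := by
      refine LinearMap.ext fun z => ?_
      have e1 : r (emb z) = z := LinearMap.congr_fun hre z
      have e2 : r (σ (a z)) = 0 := LinearMap.congr_fun hrσ (a z)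
      rw [LinearMap.comp_apply, LinearMap.sub_apply, map_sub, LinearMap.comp_apply, e1, e2]
      exact sub_zero z
    rw [LinearMap.comp_assoc, ← LinearMap.comp_assoc _ _ r, this, LinearMap.id_comp]
  · rw [← LinearMap.comp_assoc, LinearMap.comp_sub, ← LinearMap.comp_assoc, hσ, h1, sub_self,
      LinearMap.zero_comp]
  · have hrs : LinearMap.range r = ⊤ := LinearMap.range_eq_top.2 fun z =>
      ⟨emb z, LinearMap.congr_fun hre z⟩
    rw [LinearMap.range_comp, hrs]
    exact (Module.Finite.fg_top).map _
  · intro k hk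
    have h3 : a (r k) = 0 := LinearMap.congr_fun h2 ⟨k, hk⟩
    simp [her k hk, h3]

variable {R : Type u} [CommRing R] {I : ℤ → Type u} [∀ i, AddCommGroup (I i)]
  [∀ i, Module R (I i)] (d : ∀ i : ℤ, I (i + 1) →ₗ[R] I i)

theorem GiL.tensor_free {D : Type u} [AddCommGroup D] [Module R D] (hD : GiL d D) (ι : Type u) :
    GiL d (D ⊗[R] (ι →₀ R)) := by
  classical
  let e := TensorProduct.finsuppScalarRight R R D ι
  exact (hD.finsupp d ι).retract d e.toLinearMap e.symm.toLinearMap (by ext; simp)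

set_option maxHeartbeats 1000000 in
theorem GiL.tensor_flat (hI : ∀ i, Module.Injective R (I i)) (hd : ∀ i, d i ∘ₗ d (i + 1) = 0)
    {D : Type u} [AddCommGroup D] [Module R D] (hD : GiL d D) (L : Type u) [AddCommGroup L]
    [Module R L] [Module.Flat R L] : GiL d (D ⊗[R] L) := by
  set π := Finsupp.linearCombination R (Prod.fst : L × ℕ → L) with hπ
  have hsurj : Function.Surjective π := fun l => ⟨Finsupp.single (l, 0) 1, by simp [π]⟩
  let C : Set (Submodule R (D ⊗[R] ((L × ℕ) →₀ R))) :=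
    {N | ∃ θ : ((L × ℕ) →₀ R) →ₗ[R] ((L × ℕ) →₀ R), θ ∘ₗ θ = θ ∧ π ∘ₗ θ = 0 ∧
      (LinearMap.range θ).FG ∧ N = LinearMap.range (θ.lTensor D)}
  have key : ∀ K : Submodule R ((L × ℕ) →₀ R), K.FG → K ≤ LinearMap.ker π → 
      ∃ θ : ((L × ℕ) →₀ R) →ₗ[R] ((L × ℕ) →₀ R), θ ∘ₗ θ = θ ∧ π ∘ₗ θ = 0 ∧
      (LinearMap.range θ).FG ∧ ∀ k ∈ K, θ k = k := by
    intro K hK hKL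
    exact gi_idem K hK hKL
  have hC0 : C.Nonempty := by
    obtain ⟨θ, h1, h2, h3, _⟩ := key ⊥ Submodule.fg_bot bot_le
    exact ⟨_, θ, h1, h2, h3, rfl⟩
  have hCd : DirectedOn (· ≤ ·) C := by
    rintro _ ⟨θ₁, h11, h12, h13, rfl⟩ _ ⟨θ₂, h21, h22, h23, rfl⟩
    obtain ⟨θ, h1, h2, h3, h4⟩ := key (LinearMap.range θ₁ ⊔ LinearMap.range θ₂) (h13.sup h23)
      (sup_le (LinearMap.range_le_ker_iff.2 h12) (LinearMap.range_le_ker_iff.2 h22))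
    have e1 : θ ∘ₗ θ₁ = θ₁ := by
      ext1; ext1; exact h4 _ (Submodule.mem_sup_left ⟨_, rfl⟩)
    have e2 : θ ∘ₗ θ₂ = θ₂ := by
      ext1; ext1; exact h4 _ (Submodule.mem_sup_right ⟨_, rfl⟩)
    refine ⟨_, ⟨θ, h1, h2, h3, rfl⟩, ?_, ?_⟩
    · rw [← e1, LinearMap.lTensor_comp]; exact LinearMap.range_comp_le_range _ _
    · rw [← e2, LinearMap.lTensor_comp]; exact LinearMap.range_comp_le_range _ _
  have hCL : ∀ N ∈ C, GiL d N := by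
    rintro _ ⟨θ, h1, h2, h3, rfl⟩
    refine (hD.tensor_free d (L × ℕ)).retract d (Submodule.subtype _) (LinearMap.rangeRestrict _) ?_
    ext ⟨x, y, rfl⟩
    have := LinearMap.congr_fun (congrArg (LinearMap.lTensor D) h1) y
    rw [LinearMap.lTensor_comp] at this
    exact this
  have hsup : sSup C = LinearMap.ker (π.lTensor D) := by
    apply le_antisymm
    · refine sSup_le ?_
      rintro _ ⟨θ, h1, h2, h3, rfl⟩
      rw [LinearMap.range_le_ker_iff, ← LinearMap.lTensor_comp, h2, LinearMap.lTensor_zero]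
    · have hex : Function.Exact ((LinearMap.ker π).subtype.lTensor D) (π.lTensor D) :=
        gi_lTensor_ker D π hsurj
      rw [hex.linearMap_ker_eq]
      rintro _ ⟨z, rfl⟩
      induction z with
      | zero => simp
      | add a b ha hb => rw [map_add]; exact add_mem ha hb
      | tmul x k =>
        obtain ⟨θ, h1, h2, h3, h4⟩ := key (Submodule.span R {k.1}) (Submodule.fg_span_singleton _)
          (by rw [Submodule.span_singleton_le_iff_mem]; exact k.2)
        have h6 : LinearMap.range (θ.lTensor D) ∈ C := ⟨θ, h1, h2, h3, rfl⟩
        refine (le_sSup h6) ?_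
        have h5 : θ k.1 = k.1 := h4 _ (Submodule.mem_span_singleton_self k.1)
        refine ⟨x ⊗ₜ k.1, ?_⟩
        rw [LinearMap.lTensor_tmul, LinearMap.lTensor_tmul, h5, Submodule.subtype_apply]
  have hker : GiL d (LinearMap.ker (π.lTensor D)) := hsup ▸ GiL.directed d hI hd C hC0 hCd hCL
  exact GiL.coker d hI hd (Submodule.subtype _) (π.lTensor D) (Submodule.subtype_injective _)
    (LinearMap.lTensor_surjective D hsurj) (LinearMap.exact_subtype_ker_map _) hker
    (hD.tensor_free d (L × ℕ))
end GiFlat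

section GiTor
open TensorProduct
variable {R : Type u} [CommRing R]

theorem gi_balance {G A P B : Type u} [AddCommGroup A] [Module R A]
    [AddCommGroup G] [Module R G] [AddCommGroup P] [Module R P] [AddCommGroup B] [Module R B]
    [Module.Flat R G] (p : G →ₗ[R] A) (hp : Function.Surjective p)
    (q : P →ₗ[R] B) (hq : Function.Surjective q)
    (h : Function.Injective ((LinearMap.ker p).subtype.rTensor B)) :
    Function.Injective ((LinearMap.ker q).subtype.lTensor A) := by
  rw [injective_iff_map_eq_zero]
  intro x hx
  obtain ⟨y, rfl⟩ := LinearMap.rTensor_surjective (LinearMap.ker q) hp x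
  have e1 : Function.Exact ((LinearMap.ker p).subtype.rTensor P) (p.rTensor P) :=
    rTensor_exact P (LinearMap.exact_subtype_ker_map p) hp
  have e1' : Function.Exact ((LinearMap.ker p).subtype.rTensor (LinearMap.ker q))
      (p.rTensor (LinearMap.ker q)) :=
    rTensor_exact _ (LinearMap.exact_subtype_ker_map p) hp
  have e2 : Function.Exact ((LinearMap.ker q).subtype.lTensor (LinearMap.ker p))
    (q.lTensor (LinearMap.ker p)) := lTensor_exact _ (LinearMap.exact_subtype_ker_map q) hq
  have e3 : Function.Exact ((LinearMap.ker q).subtype.lTensor G)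
    (q.lTensor G) := lTensor_exact _ (LinearMap.exact_subtype_ker_map q) hq
  have c1 : p.rTensor P ((LinearMap.ker q).subtype.lTensor G y) = 0 := by
    rw [← hx, ← LinearMap.comp_apply, ← LinearMap.comp_apply, LinearMap.rTensor_comp_lTensor,
      LinearMap.lTensor_comp_rTensor]
  obtain ⟨w, hw⟩ := (e1 _).1 c1
  have c2 : q.lTensor (LinearMap.ker p) w = 0 := by
    apply h
    rw [map_zero, ← LinearMap.comp_apply, LinearMap.rTensor_comp_lTensor,
      ← LinearMap.lTensor_comp_rTensor, LinearMap.comp_apply, hw]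
    exact e3.apply_apply_eq_zero _
  obtain ⟨v, rfl⟩ := (e2 _).1 c2
  have hG : Function.Injective ((LinearMap.ker q).subtype.lTensor G) :=
    Module.Flat.lTensor_preserves_injective_linearMap _ (Submodule.subtype_injective _)
  have : y = (LinearMap.ker p).subtype.rTensor (LinearMap.ker q) v := by
    apply hG
    rw [← hw, ← LinearMap.comp_apply, ← LinearMap.comp_apply, LinearMap.rTensor_comp_lTensor,
      LinearMap.lTensor_comp_rTensor]
  rw [this]
  exact e1'.apply_apply_eq_zero _

theorem gi_balance' {G A P B : Type u} [AddCommGroup A] [Module R A]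
    [AddCommGroup G] [Module R G] [AddCommGroup P] [Module R P] [AddCommGroup B] [Module R B]
    [Module.Flat R P] (p : G →ₗ[R] A) (hp : Function.Surjective p)
    (q : P →ₗ[R] B) (hq : Function.Surjective q)
    (h : Function.Injective ((LinearMap.ker q).subtype.lTensor A)) :
    Function.Injective ((LinearMap.ker p).subtype.rTensor B) := by
  rw [← LinearMap.lTensor_inj_iff_rTensor_inj]
  rw [LinearMap.lTensor_inj_iff_rTensor_inj] at h
  exact gi_balance q hq p hp h

/-- free cover -/
noncomputable abbrev giCov (R : Type u) [CommRing R] (B : Type u) [AddCommGroup B] [Module R B] :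
    (B →₀ R) →ₗ[R] B := Finsupp.linearCombination R id

theorem giCov_surj (B : Type u) [AddCommGroup B] [Module R B] :
    Function.Surjective (giCov R B) := fun b => ⟨Finsupp.single b 1, by simp⟩

/-- vanishing of Tor in degree n+1 -/
def GiTorV (R : Type u) [CommRing R] (A : Type u) [AddCommGroup A] [Module R A] :
    ℕ → (B : Type u) → [AddCommGroup B] → [Module R B] → Prop
  | 0, B, _, _ => Function.Injective ((LinearMap.ker (giCov R B)).subtype.lTensor A)
  | n + 1, B, _, _ => GiTorV R A n (LinearMap.ker (giCov R B))

theorem GiTorV.shift {G A : Type u} [AddCommGroup A] [Module R A]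
    [AddCommGroup G] [Module R G] [Module.Flat R G] (p : G →ₗ[R] A) (hp : Function.Surjective p)
    (n : ℕ) : ∀ (B : Type u) [AddCommGroup B] [Module R B], GiTorV R (LinearMap.ker p) n B →
      GiTorV R A (n + 1) B := by
  induction n with
  | succ n ih => intro B _ _ h; exact ih _ h
  | zero =>
    intro B _ _ h
    unfold GiTorV at h
    refine gi_balance p hp (giCov R _) (giCov_surj _) ?_
    have h1 : Function.Injective ((LinearMap.ker p).subtype.rTensor (B →₀ R)) :=
      Module.Flat.rTensor_preserves_injective_linearMap _ (Submodule.subtype_injective _)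
    have h2 := h1.comp h
    rw [← LinearMap.coe_comp, LinearMap.rTensor_comp_lTensor, ← LinearMap.lTensor_comp_rTensor,
      LinearMap.coe_comp] at h2
    exact h2.of_comp

/-- evaluation -/
noncomputable def giEv (D E' N : Type u) [AddCommGroup D] [Module R D] [AddCommGroup E']
    [Module R E'] [AddCommGroup N] [Module R N] :
    N ⊗[R] (D →ₗ[R] E') →ₗ[R] ((N →ₗ[R] D) →ₗ[R] E') :=
  TensorProduct.lift (LinearMap.mk₂ R (fun n h => h ∘ₗ LinearMap.applyₗ n)
    (by intros; ext; simp) (by intros; ext; simp) (by intros; ext; simp) (by intros; ext; simp))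

@[simp] theorem giEv_tmul {D E' N : Type u} [AddCommGroup D] [Module R D] [AddCommGroup E']
    [Module R E'] [AddCommGroup N] [Module R N] (n : N) (h : D →ₗ[R] E') (φ : N →ₗ[R] D) :
    giEv D E' N (n ⊗ₜ h) φ = h (φ n) := by simp [giEv]

theorem giEv_nat {D E' N N' : Type u} [AddCommGroup D] [Module R D] [AddCommGroup E']
    [Module R E'] [AddCommGroup N] [Module R N] [AddCommGroup N'] [Module R N'] (p : N →ₗ[R] N')
    (x : N ⊗[R] (D →ₗ[R] E')) (φ : N' →ₗ[R] D) :
    giEv D E' N' (p.rTensor _ x) φ = giEv D E' N x (φ ∘ₗ p) := by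
  induction x with
  | zero => simp
  | add a b ha hb => simp [ha, hb]
  | tmul n h => simp

theorem giEv_free (D E' : Type u) [AddCommGroup D] [Module R D] [AddCommGroup E']
    [Module R E'] (n : ℕ) : Function.Bijective (giEv (R := R) D E' (Fin n → R)) := by
  classical
  let u : Fin n → D → ((Fin n → R) →ₗ[R] D) := fun i x =>
    (LinearMap.toSpanSingleton R D x) ∘ₗ LinearMap.proj i
  have hrep : ∀ x : (Fin n → R) ⊗[R] (D →ₗ[R] E'), ∃ h : Fin n → (D →ₗ[R] E'),
      x = ∑ i, Pi.single i (1 : R) ⊗ₜ h i := by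
    intro x
    induction x with
    | zero => exact ⟨0, by simp⟩
    | add a b ha hb =>
      obtain ⟨h, rfl⟩ := ha
      obtain ⟨h', rfl⟩ := hb
      exact ⟨h + h', by simp [TensorProduct.tmul_add, Finset.sum_add_distrib]⟩
    | tmul a h =>
      refine ⟨fun i => a i • h, ?_⟩
      conv_lhs => rw [pi_eq_sum_univ' a, TensorProduct.sum_tmul]
      refine Finset.sum_congr rfl fun i _ => ?_
      rw [TensorProduct.tmul_smul, TensorProduct.smul_tmul']
  constructor
  · rw [injective_iff_map_eq_zero]
    intro x hx
    obtain ⟨h, rfl⟩ := hrep x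
    refine Finset.sum_eq_zero fun i _ => ?_
    have : h i = 0 := by
      ext x
      have := LinearMap.congr_fun hx (u i x)
      simp only [map_sum, LinearMap.sum_apply, giEv_tmul, LinearMap.zero_apply] at this
      rw [Finset.sum_eq_single i] at this
      · simpa [u] using this
      · intro b _ hb
        simp [u, hb.symm]
      · simp
    rw [this, TensorProduct.tmul_zero]
  · intro ψ
    let U : Fin n → D →ₗ[R] ((Fin n → R) →ₗ[R] D) := fun i =>
      LinearMap.mk₂ R (fun x a => a i • x) (by simp) (by intros; exact smul_comm _ _ _) (by intros; simp [add_smul]) (by intros; simp [mul_smul])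
    refine ⟨∑ i, Pi.single i (1 : R) ⊗ₜ (ψ ∘ₗ U i), ?_⟩
    ext φ
    simp only [map_sum, LinearMap.sum_apply, giEv_tmul, LinearMap.comp_apply]
    rw [← map_sum]
    congr 1
    ext j
    simp [U, Pi.single_apply]

theorem giEv_surj (D E' N : Type u) [AddCommGroup D] [Module R D] [AddCommGroup E']
    [Module R E'] [AddCommGroup N] [Module R N] (hE : Module.Injective R E') [Module.Finite R N] :
    Function.Surjective (giEv (R := R) D E' N) := by
  obtain ⟨n, p, hp⟩ := Module.Finite.exists_fin' R N
  intro ψ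
  obtain ⟨χ, hχ⟩ := hE.out (LinearMap.lcomp R D p)
    (fun a b h => (LinearMap.cancel_right hp).1 h) ψ
  obtain ⟨y, rfl⟩ := (giEv_free D E' n).2 χ
  refine ⟨p.rTensor _ y, ?_⟩
  ext φ
  rw [giEv_nat, ← hχ]
  rfl

theorem giEv_bij [IsNoetherianRing R] (D E' N : Type u) [AddCommGroup D] [Module R D]
    [AddCommGroup E'] [Module R E'] [AddCommGroup N] [Module R N] (hE : Module.Injective R E')
    [Module.Finite R N] :
    Function.Bijective (giEv (R := R) D E' N) := by
  refine ⟨?_, giEv_surj D E' N hE⟩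
  obtain ⟨n, p, hp⟩ := Module.Finite.exists_fin' R N
  rw [injective_iff_map_eq_zero]
  intro x hx
  obtain ⟨y, rfl⟩ := LinearMap.rTensor_surjective _ hp x
  let res : ((Fin n → R) →ₗ[R] D) →ₗ[R] (LinearMap.ker p →ₗ[R] D) :=
    LinearMap.lcomp R D (LinearMap.ker p).subtype
  have hker : LinearMap.ker res ≤ LinearMap.ker (giEv D E' _ y) := by
    intro φ hφ
    have hφ' : LinearMap.ker p ≤ LinearMap.ker φ := fun z hz =>
      LinearMap.congr_fun hφ ⟨z, hz⟩
    let φ' : N →ₗ[R] D := (LinearMap.ker p).liftQ φ hφ' ∘ₗ (p.quotKerEquivOfSurjective hp).symm.toLinearMap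
    have : φ' ∘ₗ p = φ := by
      ext z
      simp only [φ', LinearMap.comp_apply, LinearEquiv.coe_coe]
      rw [← LinearMap.quotKerEquivOfSurjective_apply_mk p hp, LinearEquiv.symm_apply_apply]
      simp
    have h2 := LinearMap.congr_fun hx φ'
    rw [giEv_nat, this] at h2
    exact h2
  let ρ : LinearMap.range res →ₗ[R] E' := (LinearMap.ker res).liftQ _ hker ∘ₗ
    (res.quotKerEquivRange).symm.toLinearMap
  obtain ⟨ψ, hψ⟩ := hE.out (LinearMap.range res).subtype (Submodule.subtype_injective _) ρ
  obtain ⟨z, rfl⟩ := giEv_surj D E' (LinearMap.ker p) hE ψ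
  have : y = (LinearMap.ker p).subtype.rTensor _ z := by
    apply (giEv_free D E' n).1
    ext1 φ
    rw [giEv_nat]
    have h3 := hψ ⟨res φ, φ, rfl⟩
    refine Eq.trans ?_ h3.symm
    have : (res.quotKerEquivRange).symm ⟨res φ, φ, rfl⟩ = Submodule.Quotient.mk φ := by
      rw [LinearEquiv.symm_apply_eq]; rfl
    simp only [ρ, LinearMap.comp_apply, LinearEquiv.coe_coe]
    rw [this]
    simp
  rw [this]
  exact (rTensor_exact _ (LinearMap.exact_subtype_ker_map p) hp).apply_apply_eq_zero _

theorem gi_tor_of_ext [IsNoetherianRing R] (D E' : Type u) [AddCommGroup D] [Module R D]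
    [AddCommGroup E'] [Module R E'] (hE : Module.Injective R E') (n : ℕ) :
    ∀ (A : Type u) [AddCommGroup A] [Module R A] [Module.Finite R A],
      GiExtV (R := R) D (n + 1) A → GiTorV R A n (D →ₗ[R] E') := by
  induction n with
  | zero =>
    intro A _ _ _ h
    obtain ⟨n, p, hp⟩ := Module.Finite.exists_fin' R A
    refine gi_balance p hp (giCov R _) (giCov_surj _) ?_
    rw [injective_iff_map_eq_zero]
    intro x hx
    apply (giEv_bij D E' (LinearMap.ker p) hE).1
    refine LinearMap.ext fun φ => ?_
    obtain ⟨f, rfl⟩ := gi_ext_one p hp h φ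
    rw [← giEv_nat, hx, map_zero, map_zero, LinearMap.zero_apply, LinearMap.zero_apply]
  | succ n ih =>
    intro A _ _ _ h
    obtain ⟨m, p, hp⟩ := Module.Finite.exists_fin' R A
    exact GiTorV.shift p hp n _ (ih _ (gi_ext_shift p hp (n + 1) h (by omega)))

theorem gi_DH [IsNoetherianRing R] (D E' : Type u) [AddCommGroup D] [Module R D] [Module.Finite R D]
    [AddCommGroup E'] [Module R E'] (hE : Module.Injective R E')
    (hh : Function.Bijective (fun r : R => (r • (LinearMap.id : D →ₗ[R] D)))) :
    Nonempty (D ⊗[R] (D →ₗ[R] E') ≃ₗ[R] E') := by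
  let e : R ≃ₗ[R] (D →ₗ[R] D) := LinearEquiv.ofBijective
    (LinearMap.toSpanSingleton R _ (LinearMap.id : D →ₗ[R] D)) hh
  exact ⟨(LinearEquiv.ofBijective _ (giEv_bij D E' D hE)).trans
    ((LinearEquiv.congrLeft E' R e.symm).trans (LinearMap.ringLmapEquivSelf R R E'))⟩
end GiTor

section GiFin
open TensorProduct
variable {R : Type u} [CommRing R]

theorem gi_th_nat {N N' E Q : Type u} [AddCommGroup N] [Module R N] [AddCommGroup N'] [Module R N']
    [AddCommGroup E] [Module R E] [AddCommGroup Q] [Module R Q] (p : N →ₗ[R] N')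
    (x : (N' →ₗ[R] E) ⊗[R] Q) :
    rTensorHomToHomRTensor (RingHom.id R) N E Q ((LinearMap.lcomp R E p).rTensor Q x) =
      rTensorHomToHomRTensor (RingHom.id R) N' E Q x ∘ₗ p := by
  induction x with
  | zero => simp
  | add a b ha hb => rw [map_add, map_add, map_add, ha, hb, LinearMap.add_comp]
  | tmul f q => ext; simp

theorem gi_th_nat2 {N E Q Q' : Type u} [AddCommGroup N] [Module R N] [AddCommGroup Q'] [Module R Q']
    [AddCommGroup E] [Module R E] [AddCommGroup Q] [Module R Q] (d : Q →ₗ[R] Q')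
    (x : (N →ₗ[R] E) ⊗[R] Q) :
    rTensorHomToHomRTensor (RingHom.id R) N E Q' (d.lTensor _ x) =
      d.lTensor E ∘ₗ rTensorHomToHomRTensor (RingHom.id R) N E Q x := by
  induction x with
  | zero => simp
  | add a b ha hb => rw [map_add, map_add, map_add, ha, hb, LinearMap.comp_add]
  | tmul f q => ext; simp

theorem gi_th_free (E Q : Type u) [AddCommGroup E] [Module R E] [AddCommGroup Q] [Module R Q]
    (n : ℕ) : Function.Bijective (rTensorHomToHomRTensor (RingHom.id R) (Fin n → R) E Q) := by
  have : rTensorHomToHomRTensor (RingHom.id R) (Fin n → R) E Q =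
    (rTensorHomEquivHomRTensor R (Fin n → R) E Q).toLinearMap := by
    rw [rTensorHomEquivHomRTensor_toLinearMap]
  rw [this]
  exact (rTensorHomEquivHomRTensor R (Fin n → R) E Q).bijective

theorem gi_th_inj (N E Q : Type u) [AddCommGroup N] [Module R N] [Module.Finite R N]
    [AddCommGroup E] [Module R E] [AddCommGroup Q] [Module R Q] [Module.Flat R Q] :
    Function.Injective (rTensorHomToHomRTensor (RingHom.id R) N E Q) := by
  obtain ⟨n, p, hp⟩ := Module.Finite.exists_fin' R N
  have h1 : Function.Injective (LinearMap.lcomp R E p) :=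
    fun a b h => (LinearMap.cancel_right hp).1 h
  have h2 := Module.Flat.rTensor_preserves_injective_linearMap (M := Q) _ h1
  intro x y hxy
  apply h2
  apply (gi_th_free E Q n).1
  rw [gi_th_nat, gi_th_nat, hxy]

theorem gi_th_bij [IsNoetherianRing R] (N E Q : Type u) [AddCommGroup N] [Module R N]
    [Module.Finite R N]
    [AddCommGroup E] [Module R E] [AddCommGroup Q] [Module R Q] [Module.Flat R Q] :
    Function.Bijective (rTensorHomToHomRTensor (RingHom.id R) N E Q) := by
  refine ⟨gi_th_inj N E Q, ?_⟩
  obtain ⟨n, p, hp⟩ := Module.Finite.exists_fin' R N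
  intro ψ
  obtain ⟨y, hy⟩ := (gi_th_free E Q n).2 (ψ ∘ₗ p)
  have hex : Function.Exact (LinearMap.lcomp R E p) (LinearMap.lcomp R E (LinearMap.ker p).subtype) :=
    LinearMap.exact_lcomp_of_exact_of_surjective _ (LinearMap.exact_subtype_ker_map p) hp
  have hex2 := Module.Flat.rTensor_exact Q hex
  obtain ⟨x, hx⟩ := (hex2 y).1 (by
    apply gi_th_inj
    rw [gi_th_nat, hy, map_zero]
    ext z
    have : p z = 0 := z.2
    simp [this])
  refine ⟨x, ?_⟩
  apply (LinearMap.cancel_right hp).1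
  rw [← gi_th_nat, hx, hy]

theorem gi_inj_tensor [IsNoetherianRing R] (E Q : Type u)
    [AddCommGroup E] [Module R E] [AddCommGroup Q] [Module R Q] [Module.Flat R Q]
    (hE : Module.Injective R E) : Module.Injective R (E ⊗[R] Q) := by
  apply Module.Baer.injective
  intro 𝔞 g
  obtain ⟨x, rfl⟩ := (gi_th_bij 𝔞 E Q).2 g
  have hs : Function.Surjective (LinearMap.lcomp R E (Submodule.subtype 𝔞)) := by
    intro f
    obtain ⟨h, hh⟩ := hE.out (Submodule.subtype 𝔞) (Submodule.subtype_injective _) f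
    exact ⟨h, LinearMap.ext hh⟩
  obtain ⟨y, rfl⟩ := LinearMap.rTensor_surjective Q hs x
  refine ⟨rTensorHomToHomRTensor (RingHom.id R) R E Q y, fun z hz => ?_⟩
  rw [gi_th_nat]
  rfl

variable {F : ℤ → Type u} [∀ i, AddCommGroup (F i)]
  [∀ i, Module R (F i)] (d : ∀ i : ℤ, F (i + 1) →ₗ[R] F i)

/-- tensor exactness -/
def GiT (B : Type u) [AddCommGroup B] [Module R B] : Prop :=
  ∀ i, Function.Exact ((d (i + 1)).lTensor B) ((d i).lTensor B)

theorem GiT.homD [IsNoetherianRing R] (hF : ∀ i, Module.Flat R (F i)) (D E : Type u)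
    [AddCommGroup D] [Module R D] [Module.Finite R D] [AddCommGroup E] [Module R E]
    (h : GiT d (D →ₗ[R] E)) : GiL (I := fun i => E ⊗[R] F i) (fun i => (d i).lTensor E) D := by
  intro i g hg
  have := hF i
  have := hF (i + 1)
  obtain ⟨x, rfl⟩ := (gi_th_bij D E (F (i + 1))).2 g
  obtain ⟨y, rfl⟩ := (h i x).1 (by
    apply gi_th_inj D E (F i)
    rw [gi_th_nat2, hg, map_zero])
  exact ⟨_, (gi_th_nat2 _ _).symm⟩

theorem GiT.flat (hd : ∀ i, Function.Exact (d (i + 1)) (d i)) (B : Type u) [AddCommGroup B]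
    [Module R B] [Module.Flat R B] : GiT d B := fun i => Module.Flat.lTensor_exact B (hd i)

theorem GiT.coker (hd : ∀ i, Function.Exact (d (i + 1)) (d i)) (hF : ∀ i, Module.Flat R (F i))
    {P B : Type u} [AddCommGroup B] [Module R B]
    [AddCommGroup P] [Module R P] (p : P →ₗ[R] B) (hp : Function.Surjective p)
    (hK : GiT d (LinearMap.ker p)) (hP : GiT d P) : GiT d B := by
  intro i
  obtain ⟨j, rfl⟩ : ∃ j, i = j + 1 := ⟨i - 1, by omega⟩
  have hdd : ∀ i, d i ∘ₗ d (i + 1) = 0 := fun i => (hd i).linearMap_comp_eq_zero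
  have sq : ∀ {X Y : Type u} [AddCommGroup X] [Module R X] [AddCommGroup Y] [Module R Y]
      (a : X →ₗ[R] Y) (i : ℤ) (z : X ⊗[R] F (i + 1)),
      a.rTensor _ ((d i).lTensor X z) = (d i).lTensor Y (a.rTensor _ z) := by
    intro X Y _ _ _ _ a i z
    rw [← LinearMap.comp_apply, ← LinearMap.comp_apply, LinearMap.rTensor_comp_lTensor,
      LinearMap.lTensor_comp_rTensor]
  intro b
  constructor
  · intro hb
    obtain ⟨y, rfl⟩ := LinearMap.rTensor_surjective _ hp b
    rw [← sq] at hb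
    have ex : ∀ i, Function.Exact ((LinearMap.ker p).subtype.rTensor (F i)) (p.rTensor (F i)) :=
      fun i => rTensor_exact _ (LinearMap.exact_subtype_ker_map p) hp
    obtain ⟨w, hw⟩ := (ex _ _).1 hb
    have := hF j
    have hinj : Function.Injective ((LinearMap.ker p).subtype.rTensor (F j)) :=
      Module.Flat.rTensor_preserves_injective_linearMap _ (Submodule.subtype_injective _)
    obtain ⟨v, rfl⟩ := (hK j w).1 (by
      apply hinj
      rw [sq, hw, map_zero]
      exact (hP j).apply_apply_eq_zero _)
    rw [sq] at hw
    obtain ⟨u, hu⟩ := (hP (j + 1) (y - (LinearMap.ker p).subtype.rTensor _ v)).1 (by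
      rw [map_sub, hw, sub_self])
    refine ⟨p.rTensor _ u, ?_⟩
    rw [← sq, hu, map_sub, (ex _).apply_apply_eq_zero, sub_zero]
  · rintro ⟨c, rfl⟩
    rw [← LinearMap.comp_apply, ← LinearMap.lTensor_comp, hdd, LinearMap.lTensor_zero,
      LinearMap.zero_apply]

/-- flat dimension at most n -/
def GiFd (R : Type u) [CommRing R] (n : ℕ) (B : Type u) [AddCommGroup B] [Module R B] : Prop :=
  ∀ 𝔞 : Ideal R, GiTorV R (R ⧸ 𝔞) n B

theorem GiFd.zero {B : Type u} [AddCommGroup B] [Module R B] (h : GiFd R 0 B) :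
    Module.Flat R B := by
  rw [Module.Flat.iff_rTensor_injective']
  intro 𝔞
  have := gi_balance' (Submodule.mkQ 𝔞) (Submodule.mkQ_surjective _) (giCov R B) (giCov_surj B) (h 𝔞)
  rw [Submodule.ker_mkQ] at this
  exact this

theorem GiT.of_fd (hd : ∀ i, Function.Exact (d (i + 1)) (d i)) (hF : ∀ i, Module.Flat R (F i))
    (n : ℕ) : ∀ (B : Type u) [AddCommGroup B] [Module R B], GiFd R n B → GiT d B := by
  induction n with
  | zero => intro B _ _ h; have := h.zero; exact GiT.flat d hd B
  | succ n ih =>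
    intro B _ _ h
    exact GiT.coker d hd hF (giCov R B) (giCov_surj B) (ih _ h) (GiT.flat d hd _)

theorem GiL.of_fd {I : ℤ → Type u} [∀ i, AddCommGroup (I i)]
    [∀ i, Module R (I i)] (d : ∀ i : ℤ, I (i + 1) →ₗ[R] I i)
    (hI : ∀ i, Module.Injective R (I i)) (hd : ∀ i, d i ∘ₗ d (i + 1) = 0)
    {D : Type u} [AddCommGroup D] [Module R D] (hD : GiL d D) (n : ℕ) :
    ∀ (B : Type u) [AddCommGroup B] [Module R B], GiFd R n B → (∀ i, GiTorV R D i B) →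
      GiL d (D ⊗[R] B) := by
  induction n with
  | zero => intro B _ _ h _; have := h.zero; exact GiL.tensor_flat d hI hd hD B
  | succ n ih =>
    intro B _ _ h h'
    exact GiL.coker d hI hd ((LinearMap.ker (giCov R B)).subtype.lTensor D) ((giCov R B).lTensor D)
      (h' 0) (LinearMap.lTensor_surjective D (giCov_surj B)) (gi_lTensor_ker D _ (giCov_surj B))
      (ih _ h fun i => h' (i + 1)) (hD.tensor_free d B)

end GiFin

theorem gi_ker_equiv {R : Type u} [CommRing R] (E : Type u) {X Y Z W : Type u} [AddCommGroup E]
    [Module R E] [AddCommGroup X] [Module R X] [AddCommGroup Y] [Module R Y] [AddCommGroup Z]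
    [Module R Z] [AddCommGroup W] [Module R W] (a : X →ₗ[R] Y) (b : Y →ₗ[R] Z) (c : Z →ₗ[R] W)
    (h1 : LinearMap.range a = LinearMap.ker b) (h2 : LinearMap.range b = LinearMap.ker c)
    (h3 : LinearMap.range (a.lTensor E) = LinearMap.ker (b.lTensor E))
    (h4 : LinearMap.range (b.lTensor E) = LinearMap.ker (c.lTensor E)) :
    Nonempty (TensorProduct R E (LinearMap.ker c) ≃ₗ[R] LinearMap.ker (c.lTensor E)) := by
  let b' : Y →ₗ[R] LinearMap.ker c := b.codRestrict _ fun y => h2 ▸ ⟨y, rfl⟩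
  have hb : (LinearMap.ker c).subtype ∘ₗ b' = b := rfl
  have hs : Function.Surjective b' := by
    rintro ⟨z, hz⟩
    rw [← h2] at hz
    obtain ⟨y, rfl⟩ := hz
    exact ⟨y, rfl⟩
  have hba : b' ∘ₗ a = 0 := by
    ext x
    have : a x ∈ LinearMap.ker b := h1 ▸ ⟨x, rfl⟩
    exact this
  have hinj : Function.Injective ((LinearMap.ker c).subtype.lTensor E) := by
    rw [injective_iff_map_eq_zero]
    intro x hx
    obtain ⟨y, rfl⟩ := LinearMap.lTensor_surjective E hs x
    rw [← LinearMap.comp_apply, ← LinearMap.lTensor_comp, hb] at hx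
    have hy : y ∈ LinearMap.ker (b.lTensor E) := hx
    rw [← h3] at hy
    obtain ⟨z, rfl⟩ := hy
    rw [← LinearMap.comp_apply, ← LinearMap.lTensor_comp, hba, LinearMap.lTensor_zero,
      LinearMap.zero_apply]
  have hr : LinearMap.range ((LinearMap.ker c).subtype.lTensor E) = LinearMap.ker (c.lTensor E) := by
    rw [← h4, ← hb, LinearMap.lTensor_comp, LinearMap.range_comp, LinearMap.range_eq_top.2
      (LinearMap.lTensor_surjective E hs), Submodule.map_top]
  exact ⟨(LinearEquiv.ofInjective _ hinj).trans (LinearEquiv.ofEq _ _ hr)⟩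

/-- for `E` injective and `M` Gorenstein flat over a noetherian ring with
a dualizing module, `E ⊗_R M` is Gorenstein injective. -/
theorem isGorensteinInjective_tensor_of_injective_of_gorensteinFlat
    {R : Type u} [CommRing R] [IsNoetherianRing R]
    (D : Type u) [AddCommGroup D] [Module R D] (hD : IsDualizingModule R D)
    (E : Type u) [AddCommGroup E] [Module R E] (hE : Module.Injective R E)
    (M : Type u) [AddCommGroup M] [Module R M] (hM : IsGorensteinFlat R M) :
    IsGorensteinInjective R (TensorProduct R E M) := by
  obtain ⟨hDf, ⟨n0, hn0⟩, hDh, hDe⟩ := hD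
  obtain ⟨Φ⟩ := hM
  letI := Φ.acg
  letI := Φ.mod
  have hflat := Φ.flat
  have hd : ∀ i, Function.Exact (Φ.d (i + 1)) (Φ.d i) := fun i =>
    LinearMap.exact_iff.2 (Φ.exact i).symm
  have hdd : ∀ i, Φ.d i ∘ₗ Φ.d (i + 1) = 0 := fun i => (hd i).linearMap_comp_eq_zero
  have hI : ∀ i, Module.Injective R (TensorProduct R E (Φ.F i)) := fun i =>
    have := hflat i
    gi_inj_tensor E (Φ.F i) hE
  have hIdd : ∀ i, (Φ.d i).lTensor E ∘ₗ (Φ.d (i + 1)).lTensor E = 0 := fun i => by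
    rw [← LinearMap.lTensor_comp, hdd, LinearMap.lTensor_zero]
  have hfd : ∀ (E' : Type u) [AddCommGroup E'] [Module R E'], Module.Injective R E' →
      GiFd R n0 (D →ₗ[R] E') := fun E' _ _ hE' 𝔞 =>
    gi_tor_of_ext D E' hE' n0 _ (gi_ext_bridge _ _ _ (hn0 _ _ _ _ (Nat.lt_succ_self _)))
  have hGD : GiL (I := fun i => TensorProduct R E (Φ.F i)) (fun i => (Φ.d i).lTensor E) D :=
    GiT.homD Φ.d hflat D E (GiT.of_fd Φ.d hd hflat n0 _ (hfd E hE))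
  have hG : ∀ (E' : Type u) [AddCommGroup E'] [Module R E'], Module.Injective R E' →
      GiL (I := fun i => TensorProduct R E (Φ.F i)) (fun i => (Φ.d i).lTensor E) E' := by
    intro E' _ _ hE'
    obtain ⟨e⟩ := gi_DH D E' hE' hDh
    refine GiL.retract _ (GiL.of_fd _ hI hIdd hGD n0 (D →ₗ[R] E') (hfd E' hE') fun i =>
      gi_tor_of_ext D E' hE' i D (gi_ext_bridge _ _ _ (hDe _ (Nat.succ_pos i))))
      e.symm.toLinearMap e.toLinearMap ?_
    ext x
    simp
  obtain ⟨ε⟩ := gi_ker_equiv E (Φ.d (-1 + 1 + 1)) (Φ.d (-1 + 1)) (Φ.d (-1)) (Φ.exact _) (Φ.exact _)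
    (Φ.tensorExact E hE _) (Φ.tensorExact E hE _)
  exact ⟨{
    E := fun i => TensorProduct R E (Φ.F i)
    d := fun i => (Φ.d i).lTensor E
    inj := hI
    exact := fun i => Φ.tensorExact E hE i
    homExact := fun E' _ _ hE' i g => ⟨hG E' hE' i g, by
      rintro ⟨f, rfl⟩
      rw [← LinearMap.comp_assoc]
      have := hIdd i
      rw [this, LinearMap.zero_comp]⟩
    equiv := (LinearEquiv.lTensor E Φ.equiv).trans ε }⟩
end
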